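/- Under exactly the hypotheses of the main rate theorem for VFOSA₊ (FBS setting, parameter choices, VR(Δ_k; κ_k, Θ_k, σ_k) property and the Γ_k-conditions), assume additionally 0 < β < (2 − μ)β̄/(2 + μ) strictly, B_∞ := (Λ/β)∑_{k=0}^{∞} t_{k−1}(t_{k−1} − 1)σ_k²/Θ_k < ∞, and that there exist constants Γ̲ > 0 and Θ̲ > 0 with Γ_k ≥ Γ̲, Θ_k ≥ Θ̲, and Γ_kΘ_k ≤ Λ for all k ≥ 0. Then: (a) almost surely, ∑_{k=0}^{∞}(k + 1)‖G_λ x^k‖² < ∞, ∑_{k=0}^{∞}(k + 1)²‖F̃^k − F x^k‖² < ∞, and ∑_{k=0}^{∞}(k + 1)‖x^{k+1} − x^k‖² < ∞; (b) almost surely, lim_{k→∞} k²‖G_λ x^k‖² = 0 and lim_{k→∞} k²‖x^{k+1} − x^k‖² = 0; (c) there exists a random vector x̄ : Ω → ℝ^p with G_λ(x̄(ω)) = 0 for almost every ω such that x^k → x̄ and z^k → x̄ almost surely. -/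

import Mathlib

open MeasureTheory Filter
open scoped RealInnerProductSpace Pointwise

section Sequences

/-- Deterministic Robbins–Siegmund lemma. -/
theorem robbins_siegmund {V a b R : ℕ → ℝ} (hV : ∀ k, 0 ≤ V k) (ha : ∀ k, 0 ≤ a k)
    (hb : ∀ k, 0 ≤ b k) (hR : ∀ k, 0 ≤ R k) (hsa : Summable a) (hsb : Summable b)
    (h : ∀ k, V (k + 1) ≤ (1 + a k) * V k - R k + b k) :
    (∃ l, Tendsto V atTop (nhds l)) ∧ Summable R := by
  have hbound : ∀ n, V n ≤
      Real.exp (∑ i ∈ Finset.range n, a i) * (V 0 + ∑ i ∈ Finset.range n, b i) := by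
    intro n
    induction n with
    | zero => simp
    | succ n ih =>
      rw [Finset.sum_range_succ, Finset.sum_range_succ, Real.exp_add]
      set A := ∑ i ∈ Finset.range n, a i
      set B := ∑ i ∈ Finset.range n, b i
      have hA : 1 ≤ Real.exp A := Real.one_le_exp (Finset.sum_nonneg fun i _ => ha i)
      have h1 : 1 + a n ≤ Real.exp (a n) := by linarith [Real.add_one_le_exp (a n)]
      have h2 : 1 ≤ Real.exp (a n) := Real.one_le_exp (ha n)
      have h3 : (1 + a n) * V n ≤ Real.exp (a n) * (Real.exp A * (V 0 + B)) :=
        mul_le_mul h1 ih (hV n) (by positivity)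
      have h4 : b n ≤ Real.exp A * Real.exp (a n) * b n :=
        le_mul_of_one_le_left (hb n) (one_le_mul_of_one_le_of_one_le hA h2)
      linarith [h n, hR n]
  obtain ⟨M, hM⟩ : ∃ M, ∀ n, V n ≤ M := by
    refine ⟨Real.exp (∑' i, a i) * (V 0 + ∑' i, b i), fun n => (hbound n).trans ?_⟩
    have h1 := hsa.sum_le_tsum (Finset.range n) fun i _ => ha i
    have h2 := hsb.sum_le_tsum (Finset.range n) fun i _ => hb i
    have h3 : 0 ≤ ∑ i ∈ Finset.range n, b i := Finset.sum_nonneg fun i _ => hb i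
    have h4 := hV 0
    gcongr
  set c : ℕ → ℝ := fun k => a k * M + b k with hc
  have hsc : Summable c := (hsa.mul_right M).add hsb
  have hstep : ∀ k, V (k + 1) ≤ V k - R k + c k := fun k => by
    have := mul_le_mul_of_nonneg_left (hM k) (ha k)
    simp only [hc]
    linarith [h k]
  have hc0 : ∀ k, 0 ≤ c k := fun k =>
    add_nonneg (mul_nonneg (ha k) ((hV 0).trans (hM 0))) (hb k)
  have hcle := fun n => hsc.sum_le_tsum (Finset.range n) fun i _ => hc0 i
  constructor
  · have hanti : Antitone fun n => V n - ∑ i ∈ Finset.range n, c i :=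
      antitone_nat_of_succ_le fun n => by
        rw [Finset.sum_range_succ]
        linarith [hstep n, hR n]
    have hbdd : BddBelow (Set.range fun n => V n - ∑ i ∈ Finset.range n, c i) := by
      refine ⟨-∑' i, c i, ?_⟩
      rintro _ ⟨n, rfl⟩
      linarith [hV n, hcle n]
    have := (tendsto_atTop_ciInf hanti hbdd).add hsc.hasSum.tendsto_sum_nat
    exact ⟨_, by simpa using this⟩
  · refine summable_of_sum_range_le (c := V 0 + ∑' i, c i) hR fun n => ?_
    have : ∀ n, V n + ∑ i ∈ Finset.range n, R i ≤ V 0 + ∑ i ∈ Finset.range n, c i := by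
      intro n
      induction n with
      | zero => simp
      | succ n ih =>
        rw [Finset.sum_range_succ, Finset.sum_range_succ]
        linarith [hstep n]
    linarith [this n, hV n, hcle n]

theorem tendsto_zero_of_summable_div {a t : ℕ → ℝ} {l C : ℝ} (ha : ∀ k, 0 ≤ a k)
    (hlim : Tendsto a atTop (nhds l)) (ht : ∀ k, 0 < t k) (htC : ∀ k : ℕ, t k ≤ C * ((k : ℝ) + 1))
    (hs : Summable fun k => a k / t k) : Tendsto a atTop (nhds 0) := by
  have hl : 0 ≤ l := ge_of_tendsto' hlim ha
  rcases hl.eq_or_lt with rfl | hl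
  · exact hlim
  exfalso
  have hC : 0 < C := by simpa using (ht 0).trans_le (htC 0)
  obtain ⟨N, hN⟩ := eventually_atTop.1 (hlim.eventually (lt_mem_nhds (half_lt_self hl)))
  have h1 : Summable fun k : ℕ => ((k + N + 1 : ℕ) : ℝ)⁻¹ := by
    have h2 := ((summable_nat_add_iff N).2 hs).mul_left (2 * C / l)
    refine h2.of_nonneg_of_le (fun k => by positivity) fun k => ?_
    have h3 := hN (k + N) (by lia)
    have h4 := htC (k + N)
    have h5 := ht (k + N)
    rw [inv_eq_one_div, div_mul_div_comm, div_le_div_iff₀ (by positivity) (by positivity)]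
    push_cast at h4 ⊢
    calc 1 * (l * t (k + N)) ≤ l * (C * ((k : ℝ) + N + 1)) := by rw [one_mul]; gcongr
      _ = 2 * C * (l / 2) * ((k : ℝ) + N + 1) := by ring
      _ ≤ _ := by gcongr
  exact Real.not_summable_natCast_inv ((summable_nat_add_iff (N + 1)).1 h1)

end Sequences

section Lyapunov

variable {E : Type*} [NormedAddCommGroup E] [InnerProductSpace ℝ E]

/-- The Lyapunov function, in terms of the residual `g = G x`, `D = x - z` and `u = z - x⋆`. -/
noncomputable def lyapunov (μ β t : ℝ) (g D u : E) : ℝ :=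
  β * ((t - μ) * (t - μ - 1)) * ‖g‖ ^ 2 + (t - μ) * ⟪g, D⟫
    + (1 - μ) * (t - μ / 2) / (2 * μ * β * (t - 1)) * ‖u‖ ^ 2

theorem inner_young {α κ γ : ℝ} (hα : 0 < α) (hκ : 0 ≤ κ) (hγ : κ ≤ 2 * γ) (a b : E) :
    -(κ * ⟪a, b⟫) ≤ γ * (α * ‖a‖ ^ 2 + 1 / α * ‖b‖ ^ 2) := by
  have h1 := (neg_le_abs ⟪a, b⟫).trans (abs_real_inner_le_norm a b)
  have h2 : 0 ≤ 1 / α * (α * ‖a‖ - ‖b‖) ^ 2 := by positivity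
  have h3 : 1 / α * (α * ‖a‖ - ‖b‖) ^ 2 = α * ‖a‖ ^ 2 + 1 / α * ‖b‖ ^ 2 - 2 * (‖a‖ * ‖b‖) := by
    field_simp
    ring
  have h4 : 0 ≤ α * ‖a‖ ^ 2 + 1 / α * ‖b‖ ^ 2 := by positivity
  nlinarith [mul_le_mul_of_nonneg_left h1 hκ, mul_nonneg hκ h2,
    mul_le_mul_of_nonneg_right hγ h4]

theorem inner_displacement {v D s G : E} {a b : ℝ} (h : a • s = -D - b • G) :
    a * ⟪v, s⟫ = -⟪v, D⟫ - b * ⟪v, G⟫ := by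
  have := congrArg (fun q => ⟪v, q⟫) h
  simpa only [inner_smul_right, inner_sub_right, inner_neg_right] using this

theorem mul_le_gap {μ β βbar : ℝ} (hμ0 : 0 < μ) (hμ1 : μ < 2 / 3) (hβ0 : 0 < β)
    (hβ : β * (2 + μ) ≤ (2 - μ) * βbar) : β * μ ≤ βbar - β := by
  by_contra! h
  have h1 := mul_lt_mul_of_pos_left h (by linarith : 0 < 2 - μ)
  nlinarith [mul_pos (mul_pos hμ0 hμ0) hβ0]

theorem anchor_coeff_le {μ β t : ℝ} (hμ0 : 0 < μ) (hμ1 : μ < 2 / 3) (hβ0 : 0 < β) (ht : 1 < t) :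
    (1 - μ) * (t + μ - μ / 2) / (2 * μ * β * (t + μ - 1))
      ≤ (1 - μ) * (t - μ / 2) / (2 * μ * β * (t - 1)) := by
  have h2 : 0 < t - 1 := by linarith
  have h3 : 0 < t + μ - 1 := by linarith
  rw [div_le_div_iff₀ (by positivity) (by positivity)]
  have h0 : 0 ≤ (1 - μ) * (2 * μ * β) := mul_nonneg (by linarith) (by positivity)
  have h1 : (t + μ - μ / 2) * (t - 1) ≤ (t - μ / 2) * (t + μ - 1) := by nlinarith
  nlinarith [mul_le_mul_of_nonneg_left h1 h0]

theorem anchor_step {μ β t η : ℝ} {g w u : E} (hμ0 : 0 < μ) (hμ1 : μ < 2 / 3) (hβ0 : 0 < β)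
    (ht : 1 < t) (hη : η = 2 * β * (t - 1) / (t - μ / 2)) (hη2 : η ≤ 2 * β) :
    (1 - μ) * (t + μ - μ / 2) / (2 * μ * β * (t + μ - 1)) * ‖u - (μ / 2 * η) • (g + w)‖ ^ 2
      ≤ (1 - μ) * (t - μ / 2) / (2 * μ * β * (t - 1)) * ‖u‖ ^ 2 - (1 - μ) * (⟪g, u⟫ + ⟪w, u⟫)
        + μ * β * (‖g‖ ^ 2 + ‖w‖ ^ 2) := by
  have h1 := mul_le_mul_of_nonneg_right (anchor_coeff_le hμ0 hμ1 hβ0 ht)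
    (sq_nonneg ‖u - (μ / 2 * η) • (g + w)‖)
  have ht1 : 0 < t - 1 := by linarith
  have htν : 0 < t - μ / 2 := by linarith
  have hcη : (1 - μ) * (t - μ / 2) / (2 * μ * β * (t - 1)) * (μ * η) = 1 - μ := by
    rw [hη, div_mul_eq_mul_div, div_eq_iff (by positivity)]
    have : (t - μ / 2) * (2 * β * (t - 1) / (t - μ / 2)) = 2 * β * (t - 1) :=
      mul_div_cancel₀ _ htν.ne'
    linear_combination (1 - μ) * μ * this
  set c := (1 - μ) * (t - μ / 2) / (2 * μ * β * (t - 1))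
  have e4 : ‖u - (μ / 2 * η) • (g + w)‖ ^ 2
      = ‖u‖ ^ 2 - μ * η * (⟪g, u⟫ + ⟪w, u⟫) + (μ / 2 * η) ^ 2 * ‖g + w‖ ^ 2 := by
    rw [norm_sub_sq_real, inner_smul_right, norm_smul, mul_pow, Real.norm_eq_abs, sq_abs,
      inner_add_right, real_inner_comm, real_inner_comm w]
    ring
  have e5 : ‖g + w‖ ^ 2 ≤ 2 * ‖g‖ ^ 2 + 2 * ‖w‖ ^ 2 := by
    have := parallelogram_law_with_norm ℝ g w
    nlinarith [sq_nonneg ‖g - w‖]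
  have h2 : c * ‖u - (μ / 2 * η) • (g + w)‖ ^ 2 = c * ‖u‖ ^ 2 - (1 - μ) * (⟪g, u⟫ + ⟪w, u⟫)
      + (1 - μ) * μ * η / 4 * ‖g + w‖ ^ 2 := by
    rw [e4, ← hcη]; ring
  have h3 : (1 - μ) * μ * η / 4 * ‖g + w‖ ^ 2 ≤ μ * β / 2 * ‖g + w‖ ^ 2 := by
    have h4 : (1 - μ) * μ * η ≤ 1 * μ * (2 * β) := by
      have : 0 < η := by rw [hη]; positivity
      gcongr; linarith
    exact mul_le_mul_of_nonneg_right (by linarith) (sq_nonneg _)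
  have h5 : μ * β / 2 * ‖g + w‖ ^ 2 ≤ μ * β / 2 * (2 * ‖g‖ ^ 2 + 2 * ‖w‖ ^ 2) := by gcongr
  linarith

theorem error_coeff_le {μ β t : ℝ} (hμ0 : 0 < μ) (hμ1 : μ < 2 / 3) (hβ0 : 0 < β)
    (ht : 2 + 12 / (2 - 3 * μ) ≤ t) :
    β * t * (1 / ((2 - 3 * μ) / 2)) + μ * β ≤ β / μ * (t * (t - 1)) := by
  have hm : 0 < 2 - 3 * μ := by linarith
  have hm12 : 0 < 12 / (2 - 3 * μ) := by positivity
  have h2 : β * t * (12 / (2 - 3 * μ) + 1) ≤ β * t * (t - 1) := by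
    have : 0 < t := by linarith
    gcongr; linarith
  have h3 : β * t * (t - 1) ≤ β / μ * (t * (t - 1)) := by
    have h0 : 0 ≤ t * (t - 1) := mul_nonneg (by linarith) (by linarith)
    have : β ≤ β / μ := by rw [le_div_iff₀ hμ0]; nlinarith
    rw [mul_assoc]
    gcongr
  have h4 : μ * β ≤ β * t := by nlinarith
  have h5 : β * t * (1 / ((2 - 3 * μ) / 2)) = β * t * (12 / (2 - 3 * μ)) / 6 := by
    rw [one_div_div]; ring
  have h6 : 0 ≤ β * t * (12 / (2 - 3 * μ)) := by
    have : 0 < t := by linarith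
    positivity
  linarith

theorem residual_coeff_le {μ β t p : ℝ} (hμ1 : μ < 2 / 3) (hβ0 : 0 < β)
    (ht : 12 ≤ (2 - 3 * μ) * t) (hp : t - 1 ≤ p) :
    β * t * ((2 - 3 * μ) / 2) + β * (2 - 3 * μ) / 4 * t + μ * β
      ≤ β * (μ ^ 2 + μ - 2 * μ * t + (2 - μ) * p) := by
  have h1 : (2 - μ) * (t - 1) ≤ (2 - μ) * p := by gcongr; linarith
  have h2 : (2 - 3 * μ) / 2 * t + (2 - 3 * μ) / 4 * t + μ
    ≤ μ ^ 2 + μ - 2 * μ * t + (2 - μ) * p := by nlinarith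
  linarith [mul_le_mul_of_nonneg_left h2 hβ0.le]

theorem stepsize_le {μ β t η : ℝ} (hμ1 : μ < 2 / 3) (hβ0 : 0 < β) (ht : 1 < t)
    (hη : η = 2 * β * (t - 1) / (t - μ / 2)) : η ≤ 2 * β := by
  rw [hη, div_le_iff₀ (by linarith)]; nlinarith

theorem lyapunov_step {μ β βbar t η e : ℝ} {g g' w D D' u u' s : E}
    (hμ0 : 0 < μ) (hμ1 : μ < 2 / 3) (hβ0 : 0 < β) (hβ : β * (2 + μ) ≤ (2 - μ) * βbar)
    (ht : 2 + 12 / (2 - 3 * μ) ≤ t) (hη : η = 2 * β * (t - 1) / (t - μ / 2))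
    (hs : t • s = -D - (t * η) • (g + w)) (hD' : D' = D + s + (μ / 2 * η) • (g + w))
    (hu' : u' = u - (μ / 2 * η) • (g + w))
    (hcoc : βbar * ‖g' - g‖ ^ 2 + e ≤ ⟪g' - g, s⟫) (hsol : 0 ≤ ⟪g, D + u⟫) :
    lyapunov μ β (t + μ) g' D' u' ≤ lyapunov μ β t g D u + μ / (4 * β * (t * (t - 1))) * ‖u‖ ^ 2
      - β * (2 - 3 * μ) / 4 * t * ‖g‖ ^ 2 - t * (t - 1) * e
      + 3 * β / μ * (t * (t - 1)) * ‖w‖ ^ 2 := by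
  have hm : 0 < 2 - 3 * μ := by linarith
  have hm12 : 0 < 12 / (2 - 3 * μ) := by positivity
  have ht1 : 0 < t - 1 := by linarith
  have htν : 0 < t - μ / 2 := by linarith
  have htt : 0 < t * (t - 1) := mul_pos (by linarith) ht1
  have hmt : 12 ≤ (2 - 3 * μ) * t := by
    have : 12 / (2 - 3 * μ) ≤ t := by linarith
    rw [div_le_iff₀ hm] at this; linarith
  have hηeq : η * (t - μ / 2) = 2 * β * (t - 1) := by rw [hη, div_mul_cancel₀ _ htν.ne']
  have hs' : (t - 1) • s = -D' - (2 * β * (t - 1)) • (g + w) := by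
    rw [hD', ← hηeq, sub_smul, hs]
    module
  have e1 := inner_displacement (v := g) hs
  have e2 := inner_displacement (v := g') hs'
  rw [inner_add_right, real_inner_self_eq_norm_sq] at e1
  rw [inner_add_right] at e2
  have hu := anchor_step (u := u) (g := g) (w := w) hμ0 hμ1 hβ0 (by linarith) hη
    (stepsize_le hμ1 hβ0 (by linarith) hη)
  rw [← hu'] at hu
  rw [inner_sub_left] at hcoc
  rw [inner_add_right] at hsol
  have hd := inner_young hμ0 (by positivity : 0 ≤ 2 * β) le_rfl (g' - g) w
  have hgap := mul_le_mul_of_nonneg_right (mul_le_gap hμ0 hμ1 hβ0 hβ) (sq_nonneg ‖g' - g‖)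
  rw [inner_sub_left] at hd
  obtain ⟨p, hp, hp1, hp2⟩ : ∃ p, t * (t - 1) * η = 2 * β * (t * (t - 1)) - β * (2 - μ) * p
      ∧ t - 1 ≤ p ∧ p ≤ t := by
    refine ⟨t * (t - 1) / (t - μ / 2), ?_, ?_, ?_⟩
    · have : t * (t - 1) / (t - μ / 2) * (t - μ / 2) = t * (t - 1) := div_mul_cancel₀ _ htν.ne'
      refine mul_right_cancel₀ htν.ne' ?_
      linear_combination t * (t - 1) * hηeq + β * (2 - μ) * this
    · rw [le_div_iff₀ htν]; nlinarith
    · rw [div_le_iff₀ htν]; nlinarith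
  have b1 := inner_young (half_pos hm) (κ := β * (2 - μ) * p) (γ := β * t)
    (mul_nonneg (mul_nonneg hβ0.le (by linarith)) (by linarith))
    (by rw [mul_assoc, mul_left_comm 2]; gcongr <;> linarith) g w
  have b2 := inner_young (α := 2 * β * (t * (t - 1)) / μ) (by positivity) (κ := 1 - μ) (γ := 1 / 2)
    (by linarith) (by linarith) w u
  have b3 := mul_le_mul_of_nonneg_right (error_coeff_le hμ0 hμ1 hβ0 ht) (sq_nonneg ‖w‖)
  have b4 := mul_le_mul_of_nonneg_right (residual_coeff_le hμ1 hβ0 hmt hp1) (sq_nonneg ‖g‖)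
  have i0 : 0 ≤ t * (t - 1) * (⟪g', s⟫ - ⟪g, s⟫ - (βbar * ‖g' - g‖ ^ 2 + e)) :=
    mul_nonneg htt.le (by linarith)
  have i2 : 0 ≤ t * (t - 1) * ((βbar - β) * ‖g' - g‖ ^ 2
      + (2 * β * (⟪g', w⟫ - ⟪g, w⟫) + β * (1 / μ * ‖w‖ ^ 2))) :=
    mul_nonneg htt.le (by linarith)
  have i3 := mul_nonneg (by linarith : 0 ≤ 1 - μ) hsol
  have i4 : t * (t - 1) * (⟪g', s⟫ - ⟪g, s⟫) = -(t * ⟪g', D'⟫)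
      - 2 * β * (t * (t - 1)) * (⟪g', g⟫ + ⟪g', w⟫) + (t - 1) * ⟪g, D⟫
      + (2 * β * (t * (t - 1)) - β * (2 - μ) * p) * (‖g‖ ^ 2 + ⟪g, w⟫) := by
    rw [← hp]
    linear_combination t * e2 - (t - 1) * e1
  have k3 : 1 / (2 * β * (t * (t - 1)) / μ) = 2 * (μ / (4 * β * (t * (t - 1)))) := by
    field_simp; norm_num
  rw [k3] at b2
  rw [mul_sub, i4] at i0
  rw [norm_sub_sq_real] at i0 i2
  simp only [lyapunov, add_sub_cancel_right]
  generalize (1 - μ) * (t + μ - μ / 2) / (2 * μ * β * (t + μ - 1)) = c' at *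
  generalize (1 - μ) * (t - μ / 2) / (2 * μ * β * (t - 1)) = c at *
  generalize μ / (4 * β * (t * (t - 1))) = q at *
  generalize 1 / ((2 - 3 * μ) / 2) = m at *
  rw [div_eq_mul_one_div] at b3
  rw [div_eq_mul_one_div (3 * β) μ]
  rw [div_eq_mul_one_div _ μ] at b2
  generalize 1 / μ = n at *
  linear_combination i0 + i2 + i3 + hu + b1 + b2 + b3 + b4

theorem lyapunov_lower {μ β βbar t : ℝ} {g D u : E} (hμ0 : 0 < μ) (hμ1 : μ < 2 / 3) (hβ0 : 0 < β)
    (hβ : β ≤ βbar) (ht : 1 < t) (hsol : βbar * ‖g‖ ^ 2 ≤ ⟪g, D + u⟫) :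
    β * ((t - μ) * ‖g‖) ^ 2 - (t - μ) * ‖g‖ * ‖u‖ + (1 - μ) / (2 * μ * β) * ‖u‖ ^ 2
      ≤ lyapunov μ β t g D u := by
  have ht1 : 0 < t - 1 := by linarith
  have hτ : 0 < t - μ := by linarith
  have h1 : (1 - μ) / (2 * μ * β) ≤ (1 - μ) * (t - μ / 2) / (2 * μ * β * (t - 1)) := by
    rw [mul_div_mul_comm]
    refine le_mul_of_one_le_right (div_nonneg (by linarith) (by positivity)) ?_
    rw [one_le_div ht1]; linarith
  have h2 := mul_le_mul_of_nonneg_right h1 (sq_nonneg ‖u‖)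
  have h3 := real_inner_le_norm g u
  have h4 := mul_le_mul_of_nonneg_left h3 hτ.le
  rw [inner_add_right] at hsol
  have h5 := mul_le_mul_of_nonneg_left hsol hτ.le
  have h6 : (t - μ) * (β * ‖g‖ ^ 2) ≤ (t - μ) * (βbar * ‖g‖ ^ 2) := by gcongr
  unfold lyapunov
  linear_combination h2 + h4 + h5 + h6

theorem norm_sq_le_lyapunov {μ β βbar t : ℝ} {g D u : E} (hμ0 : 0 < μ) (hμ1 : μ < 2 / 3)
    (hβ0 : 0 < β) (hβ : β ≤ βbar) (ht : 1 < t) (hsol : βbar * ‖g‖ ^ 2 ≤ ⟪g, D + u⟫) :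
    (2 - 3 * μ) / (4 * μ * β) * ‖u‖ ^ 2 ≤ lyapunov μ β t g D u := by
  refine le_trans ?_ (lyapunov_lower hμ0 hμ1 hβ0 hβ ht hsol)
  have h1 : 0 ≤ β * ((t - μ) * ‖g‖ - 1 / (2 * β) * ‖u‖) ^ 2 := by positivity
  have h2 : β * ((t - μ) * ‖g‖ - 1 / (2 * β) * ‖u‖) ^ 2
      = β * ((t - μ) * ‖g‖) ^ 2 - (t - μ) * ‖g‖ * ‖u‖ + 1 / (4 * β) * ‖u‖ ^ 2 := by
    field_simp; ring
  have h3 : (1 - μ) / (2 * μ * β) = (2 - 3 * μ) / (4 * μ * β) + 1 / (4 * β) := by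
    field_simp; ring
  rw [h3]
  linarith

theorem residual_sq_le_lyapunov {μ β βbar t : ℝ} {g D u : E} (hμ0 : 0 < μ) (hμ1 : μ < 2 / 3)
    (hβ0 : 0 < β) (hβ : β ≤ βbar) (ht : 1 < t) (hsol : βbar * ‖g‖ ^ 2 ≤ ⟪g, D + u⟫) :
    β / 2 * ((t - μ) * ‖g‖) ^ 2 ≤ lyapunov μ β t g D u + 1 / (2 * β) * ‖u‖ ^ 2 := by
  have h := lyapunov_lower hμ0 hμ1 hβ0 hβ ht hsol
  have h1 : 0 ≤ β / 2 * ((t - μ) * ‖g‖ - 1 / β * ‖u‖) ^ 2 := by positivity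
  have h2 : β / 2 * ((t - μ) * ‖g‖ - 1 / β * ‖u‖) ^ 2
      = β / 2 * ((t - μ) * ‖g‖) ^ 2 - (t - μ) * ‖g‖ * ‖u‖ + 1 / (2 * β) * ‖u‖ ^ 2 := by
    field_simp; ring
  have h3 : 0 ≤ (1 - μ) / (2 * μ * β) * ‖u‖ ^ 2 :=
    mul_nonneg (div_nonneg (by linarith) (by positivity)) (sq_nonneg _)
  linarith

theorem lyapunov_iterate_le {μ β βbar t η e : ℝ} {G : E → E} {x x' z z' w xstar : E}
    (hμ0 : 0 < μ) (hμ1 : μ < 2 / 3) (hβ0 : 0 < β) (hβ : β * (2 + μ) ≤ (2 - μ) * βbar)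
    (ht : 2 + 12 / (2 - 3 * μ) ≤ t) (hη : η = 2 * β * (t - 1) / (t - μ / 2))
    (hG : ∀ a b, βbar * ‖G a - G b‖ ^ 2 ≤ ⟪G a - G b, a - b⟫) (hxs : G xstar = 0)
    (hx : x' = x - (1 / t) • (x - z) - η • (G x + w))
    (hz : z' = z - (μ / 2 * η) • (G x + w))
    (hcoc : βbar * ‖G x' - G x‖ ^ 2 + e ≤ ⟪G x' - G x, x' - x⟫) :
    lyapunov μ β (t + μ) (G x') (x' - z') (z' - xstar)
      ≤ (1 + μ ^ 2 / (2 - 3 * μ) * (1 / (t * (t - 1)))) * lyapunov μ β t (G x) (x - z) (z - xstar)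
        - β * (2 - 3 * μ) / 4 * t * ‖G x‖ ^ 2 - t * (t - 1) * e
        + 3 * β / μ * (t * (t - 1)) * ‖w‖ ^ 2 := by
  have hm : 0 < 2 - 3 * μ := by linarith
  have hm12 : 0 < 12 / (2 - 3 * μ) := by positivity
  have ht1 : 0 < t - 1 := by linarith
  have ht0 : 0 < t := by linarith
  have hgap := mul_le_gap hμ0 hμ1 hβ0 hβ
  have hββ : β ≤ βbar := by nlinarith
  have hsol : βbar * ‖G x‖ ^ 2 ≤ ⟪G x, (x - z) + (z - xstar)⟫ := by
    simpa [hxs] using hG x xstar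
  have h1 := lyapunov_step (t := t) (η := η) (e := e) (g := G x) (g' := G x') (w := w) (D := x - z)
    (D' := x' - z') (u := z - xstar) (u' := z' - xstar) (s := x' - x) hμ0 hμ1 hβ0 hβ ht hη
    (by
      rw [hx]
      have : t • (1 / t) • (x - z) = x - z := by
        rw [smul_smul, mul_one_div_cancel ht0.ne', one_smul]
      rw [mul_smul, ← sub_eq_zero]
      calc _ = x - z - t • (1 / t) • (x - z) := by module
        _ = 0 := by rw [this, sub_self])
    (by rw [hz]; module) (by rw [hz]; module) hcoc
    (le_trans (mul_nonneg (hβ0.le.trans hββ) (sq_nonneg _)) hsol)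
  have h2 := norm_sq_le_lyapunov (t := t) hμ0 hμ1 hβ0 hββ (by linarith) hsol
  have h3 := mul_le_mul_of_nonneg_left h2
    (by positivity : 0 ≤ μ ^ 2 / (2 - 3 * μ) * (1 / (t * (t - 1))))
  have h4 : μ ^ 2 / (2 - 3 * μ) * (1 / (t * (t - 1)))
      * ((2 - 3 * μ) / (4 * μ * β) * ‖z - xstar‖ ^ 2)
      = μ / (4 * β * (t * (t - 1))) * ‖z - xstar‖ ^ 2 := by
    generalize hM : 2 - 3 * μ = M at hm
    field_simp
  linarith

end Lyapunov

section Pathwise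

theorem norm_convex_comb_sq_le {E : Type*} [NormedAddCommGroup E] [InnerProductSpace ℝ E] {t : ℝ}
    (ht : 1 ≤ t) (D h : E) :
    ‖D - (1 / t) • D - h‖ ^ 2 ≤ ‖D‖ ^ 2 - ‖D‖ ^ 2 / t + t * ‖h‖ ^ 2 := by
  have ht0 : 0 < t := by linarith
  have h1 : ‖D - (1 / t) • D - h‖ ≤ (1 - 1 / t) * ‖D‖ + 1 / t * (t * ‖h‖) := by
    have h2 : 0 ≤ 1 - 1 / t := by rw [sub_nonneg, div_le_one ht0]; exact ht
    calc _ ≤ ‖D - (1 / t) • D‖ + ‖h‖ := norm_sub_le _ _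
      _ = ‖(1 - 1 / t) • D‖ + ‖h‖ := by rw [sub_smul, one_smul]
      _ = _ := by rw [norm_smul, Real.norm_of_nonneg h2]; field_simp
  have h2 : ((1 - 1 / t) * ‖D‖ + 1 / t * (t * ‖h‖)) ^ 2
      = ‖D‖ ^ 2 - ‖D‖ ^ 2 / t + t * ‖h‖ ^ 2 - (1 / t) * (1 - 1 / t) * (‖D‖ - t * ‖h‖) ^ 2 := by
    field_simp; ring
  have h3 : 0 ≤ (1 / t) * (1 - 1 / t) * (‖D‖ - t * ‖h‖) ^ 2 := by
    have h2 : 0 ≤ 1 - 1 / t := by rw [sub_nonneg, div_le_one ht0]; exact ht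
    positivity
  have h4 := pow_le_pow_left₀ (norm_nonneg _) h1 2
  linarith

theorem norm_add_sq_le_two_mul {E : Type*} [NormedAddCommGroup E] [InnerProductSpace ℝ E]
    (a b : E) : ‖a + b‖ ^ 2 ≤ 2 * (‖a‖ ^ 2 + ‖b‖ ^ 2) := by
  nlinarith [parallelogram_law_with_norm ℝ a b, sq_nonneg ‖a - b‖]

/-- A trajectory of VFOSA₊ for a residual map `G`, with error `w k` in the `k`-th evaluation of the
residual and square summable weighted errors. -/
structure IsTrajectory {E : Type*} [NormedAddCommGroup E] [InnerProductSpace ℝ E]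
    (μ β βbar r : ℝ) (G : E → E) (t η : ℕ → ℝ) (x z w : ℕ → E) : Prop where
  mu_pos : 0 < μ
  mu_lt : μ < 2 / 3
  beta_pos : 0 < β
  beta_le : β * (2 + μ) ≤ (2 - μ) * βbar
  r_ge : 2 + 1 / μ ≤ r
  t_eq : ∀ k : ℕ, t k = μ * ((k : ℝ) + r)
  eta_eq : ∀ k, η k = 2 * β * (t k - 1) / (t k - μ / 2)
  coercive : ∀ a b, βbar * ‖G a - G b‖ ^ 2 ≤ ⟪G a - G b, a - b⟫
  x_succ : ∀ k, x (k + 1) = x k - (1 / t k) • (x k - z k) - η k • (G (x k) + w k)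
  z_succ : ∀ k, z (k + 1) = z k - (μ / 2 * η k) • (G (x k) + w k)
  summable_error : Summable fun k => t k ^ 2 * ‖w k‖ ^ 2

theorem one_add_le_weight {μ r : ℝ} (hμ0 : 0 < μ) (hr : 2 + 1 / μ ≤ r) (k : ℕ) :
    1 + 2 * μ + μ * k ≤ μ * ((k : ℝ) + r) := by
  have h1 : 1 / μ ≤ r - 2 := by linarith
  rw [div_le_iff₀ hμ0] at h1
  linarith

theorem summable_one_div_weight {μ r : ℝ} (hμ0 : 0 < μ) (hr : 2 + 1 / μ ≤ r) :
    Summable fun k : ℕ => 1 / ((μ * ((k : ℝ) + r)) * (μ * ((k : ℝ) + r) - 1)) := by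
  have h1 : Summable fun k : ℕ => 1 / ((k + 1 : ℕ) : ℝ) ^ 2 :=
    (summable_nat_add_iff 1).2 (Real.summable_one_div_nat_pow.2 one_lt_two)
  refine (h1.mul_left (1 / μ ^ 2)).of_nonneg_of_le (fun k => ?_) fun k => ?_
  · have := one_add_le_weight hμ0 hr k
    have h3 : 0 ≤ μ * k := by positivity
    exact one_div_nonneg.2 (mul_nonneg (by linarith) (by linarith))
  · have := one_add_le_weight hμ0 hr k
    rw [one_div_mul_one_div, ← mul_pow, pow_two]
    push_cast
    refine one_div_le_one_div_of_le (by positivity) ?_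
    have h3 : 0 < μ * ((k : ℝ) + 1) := by positivity
    exact mul_le_mul (by linarith) (by linarith) h3.le (by linarith)

namespace IsTrajectory

variable {E : Type*} [NormedAddCommGroup E] [InnerProductSpace ℝ E] {μ β βbar r : ℝ} {G : E → E}
  {t η : ℕ → ℝ} {x z w : ℕ → E} {y : E}

theorem one_lt_t (h : IsTrajectory μ β βbar r G t η x z w) (k : ℕ) : 1 < t k := by
  have h1 := one_add_le_weight h.mu_pos h.r_ge k
  have h2 := h.mu_pos
  have h3 : 0 ≤ μ * k := by positivity
  rw [h.t_eq]; linarith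

theorem t_pos (h : IsTrajectory μ β βbar r G t η x z w) (k : ℕ) : 0 < t k :=
  zero_lt_one.trans (h.one_lt_t k)

theorem t_succ (h : IsTrajectory μ β βbar r G t η x z w) (k : ℕ) : t (k + 1) = t k + μ := by
  rw [h.t_eq, h.t_eq]; push_cast; ring

theorem t_le (h : IsTrajectory μ β βbar r G t η x z w) (k : ℕ) : t k ≤ μ * r * ((k : ℝ) + 1) := by
  have h0 := h.mu_pos
  have h1 : 0 < 1 / μ := by positivity
  have h2 : 0 ≤ μ * k * (r - 1) := mul_nonneg (by positivity) (by linarith [h.r_ge])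
  rw [h.t_eq]; linarith

theorem t_tendsto (h : IsTrajectory μ β βbar r G t η x z w) : Tendsto t atTop atTop := by
  rw [funext h.t_eq]
  exact (tendsto_atTop_add_const_right _ _ tendsto_natCast_atTop_atTop).const_mul_atTop h.mu_pos

theorem eta_nonneg (h : IsTrajectory μ β βbar r G t η x z w) (k : ℕ) : 0 ≤ η k := by
  have h1 := h.one_lt_t k
  have h2 := h.beta_pos
  have h3 := h.mu_lt
  rw [h.eta_eq]
  exact div_nonneg (mul_nonneg (by positivity) (by linarith)) (by linarith)

theorem eta_le (h : IsTrajectory μ β βbar r G t η x z w) (k : ℕ) : η k ≤ 2 * β :=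
  stepsize_le h.mu_lt h.beta_pos (h.one_lt_t k) (h.eta_eq k)

theorem le_betabar (h : IsTrajectory μ β βbar r G t η x z w) : β ≤ βbar := by
  have := mul_le_gap h.mu_pos h.mu_lt h.beta_pos h.beta_le
  nlinarith [mul_pos h.beta_pos h.mu_pos]

theorem coercive_sol (h : IsTrajectory μ β βbar r G t η x z w) (hy : G y = 0) (k : ℕ) :
    βbar * ‖G (x k)‖ ^ 2 ≤ ⟪G (x k), (x k - z k) + (z k - y)⟫ := by
  simpa [hy] using h.coercive (x k) y

theorem summable_inv (h : IsTrajectory μ β βbar r G t η x z w) :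
    Summable fun k => 1 / (t k * (t k - 1)) := by
  simpa only [h.t_eq] using summable_one_div_weight h.mu_pos h.r_ge

theorem le_lyapunov (h : IsTrajectory μ β βbar r G t η x z w) (hy : G y = 0) (k : ℕ) :
    (2 - 3 * μ) / (4 * μ * β) * ‖z k - y‖ ^ 2
      ≤ lyapunov μ β (t k) (G (x k)) (x k - z k) (z k - y) :=
  norm_sq_le_lyapunov h.mu_pos h.mu_lt h.beta_pos h.le_betabar (h.one_lt_t k) (h.coercive_sol hy k)

theorem lyapunov_nonneg (h : IsTrajectory μ β βbar r G t η x z w) (hy : G y = 0) (k : ℕ) :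
    0 ≤ lyapunov μ β (t k) (G (x k)) (x k - z k) (z k - y) := by
  have h1 := h.mu_pos
  have h2 := h.beta_pos
  have h3 := h.mu_lt
  exact (mul_nonneg (div_nonneg (by linarith) (by positivity)) (sq_nonneg _)).trans
    (h.le_lyapunov hy k)

theorem lyapunov_tendsto (h : IsTrajectory μ β βbar r G t η x z w) (hy : G y = 0) :
    (∃ l, Tendsto (fun k => lyapunov μ β (t k) (G (x k)) (x k - z k) (z k - y)) atTop (nhds l))
      ∧ Summable fun k => t k * ‖G (x k)‖ ^ 2 := by
  obtain ⟨N, hN⟩ := eventually_atTop.1 (h.t_tendsto.eventually_ge_atTop (2 + 12 / (2 - 3 * μ)))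
  have hμ0 := h.mu_pos
  have hm : 0 < 2 - 3 * μ := by linarith [h.mu_lt]
  have hβ0 := h.beta_pos
  obtain ⟨⟨l, hl⟩, hs⟩ := robbins_siegmund
    (V := fun k => lyapunov μ β (t (k + N)) (G (x (k + N))) (x (k + N) - z (k + N)) (z (k + N) - y))
    (a := fun k => μ ^ 2 / (2 - 3 * μ) * (1 / (t (k + N) * (t (k + N) - 1))))
    (R := fun k => β * (2 - 3 * μ) / 4 * (t (k + N) * ‖G (x (k + N))‖ ^ 2))
    (b := fun k => 3 * β / μ * (t (k + N) ^ 2 * ‖w (k + N)‖ ^ 2))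
    (fun k => h.lyapunov_nonneg hy _)
    (fun k => mul_nonneg (div_nonneg (sq_nonneg _) hm.le) (one_div_nonneg.2
      (mul_nonneg (h.t_pos _).le (by linarith [h.one_lt_t (k + N)]))))
    (fun k => mul_nonneg (by positivity) (by positivity))
    (fun k => mul_nonneg (by positivity) (mul_nonneg (h.t_pos _).le (sq_nonneg _)))
    (((summable_nat_add_iff N).2 h.summable_inv).mul_left _)
    (((summable_nat_add_iff N).2 h.summable_error).mul_left _)
    (fun k => by
      have h1 := lyapunov_iterate_le (e := 0) hμ0 h.mu_lt hβ0 h.beta_le (hN (k + N) (by lia))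
        (h.eta_eq (k + N)) h.coercive hy (h.x_succ (k + N)) (h.z_succ (k + N))
        (by rw [add_zero]; exact h.coercive _ _)
      rw [← h.t_succ, show k + N + 1 = k + 1 + N by ring] at h1
      have h2 : t (k + N) * (t (k + N) - 1) ≤ t (k + N) ^ 2 := by nlinarith [h.t_pos (k + N)]
      have h3 := mul_le_mul_of_nonneg_left (mul_le_mul_of_nonneg_right h2 (sq_nonneg ‖w (k + N)‖))
        (by positivity : 0 ≤ 3 * β / μ)
      linarith)
  refine ⟨⟨l, ?_⟩, (summable_nat_add_iff N).1 ?_⟩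
  · exact (tendsto_add_atTop_iff_nat (f := fun k =>
      lyapunov μ β (t k) (G (x k)) (x k - z k) (z k - y)) N).1 hl
  · exact (summable_mul_left_iff (by positivity : β * (2 - 3 * μ) / 4 ≠ 0)).1 hs

theorem summable_error_linear (h : IsTrajectory μ β βbar r G t η x z w) :
    Summable fun k => t k * ‖w k‖ ^ 2 :=
  h.summable_error.of_nonneg_of_le (fun k => mul_nonneg (h.t_pos k).le (sq_nonneg _))
    fun k => mul_le_mul_of_nonneg_right (by nlinarith [h.one_lt_t k]) (sq_nonneg _)

theorem summable_perturbed (h : IsTrajectory μ β βbar r G t η x z w) (hy : G y = 0) :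
    Summable fun k => t k * ‖G (x k) + w k‖ ^ 2 := by
  refine (((h.lyapunov_tendsto hy).2.add h.summable_error_linear).mul_left 2).of_nonneg_of_le
    (fun k => mul_nonneg (h.t_pos k).le (sq_nonneg _)) fun k => ?_
  have := mul_le_mul_of_nonneg_left (norm_add_sq_le_two_mul (G (x k)) (w k)) (h.t_pos k).le
  linarith

theorem gap_succ (h : IsTrajectory μ β βbar r G t η x z w) (k : ℕ) :
    x (k + 1) - z (k + 1)
      = x k - z k - (1 / t k) • (x k - z k) - ((1 - μ / 2) * η k) • (G (x k) + w k) := by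
  rw [h.x_succ, h.z_succ]; module

theorem gap_step (h : IsTrajectory μ β βbar r G t η x z w) (k : ℕ) :
    ‖x (k + 1) - z (k + 1)‖ ^ 2 ≤ ‖x k - z k‖ ^ 2 - ‖x k - z k‖ ^ 2 / t k
      + 4 * β ^ 2 * (t k * ‖G (x k) + w k‖ ^ 2) := by
  have h1 := norm_convex_comb_sq_le (h.one_lt_t k).le (x k - z k)
    (((1 - μ / 2) * η k) • (G (x k) + w k))
  rw [← h.gap_succ, norm_smul, mul_pow, Real.norm_eq_abs, sq_abs] at h1
  have h3 : ((1 - μ / 2) * η k) ^ 2 ≤ (2 * β) ^ 2 := by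
    have h4 := h.eta_nonneg k
    have h5 := h.eta_le k
    have h6 : 0 ≤ 1 - μ / 2 := by linarith [h.mu_lt]
    refine pow_le_pow_left₀ (by positivity) ?_ 2
    nlinarith [h.mu_pos]
  have h4 := mul_le_mul_of_nonneg_left (mul_le_mul_of_nonneg_right h3
    (sq_nonneg ‖G (x k) + w k‖)) (h.t_pos k).le
  linarith

theorem gap_tendsto (h : IsTrajectory μ β βbar r G t η x z w) (hy : G y = 0) :
    Tendsto (fun k => x k - z k) atTop (nhds 0) ∧ Summable fun k => ‖x k - z k‖ ^ 2 / t k := by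
  obtain ⟨⟨l, hl⟩, hs⟩ := robbins_siegmund (V := fun k => ‖x k - z k‖ ^ 2) (a := fun _ => 0)
    (R := fun k => ‖x k - z k‖ ^ 2 / t k)
    (b := fun k => 4 * β ^ 2 * (t k * ‖G (x k) + w k‖ ^ 2))
    (fun k => sq_nonneg _) (fun _ => le_rfl)
    (fun k => mul_nonneg (by positivity) (mul_nonneg (h.t_pos k).le (sq_nonneg _)))
    (fun k => div_nonneg (sq_nonneg _) (h.t_pos k).le) summable_zero
    ((h.summable_perturbed hy).mul_left (4 * β ^ 2))
    (fun k => by rw [add_zero, one_mul]; exact h.gap_step k)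
  refine ⟨tendsto_zero_iff_norm_tendsto_zero.2 ?_, hs⟩
  have := (tendsto_zero_of_summable_div (fun k => sq_nonneg _) hl h.t_pos h.t_le hs).sqrt
  simpa using this

theorem anchor_bounded (h : IsTrajectory μ β βbar r G t η x z w) (hy : G y = 0) :
    ∃ M, ∀ k, ‖z k‖ ≤ M := by
  have hμ0 := h.mu_pos
  have hm : 0 < 2 - 3 * μ := by linarith [h.mu_lt]
  have hβ0 := h.beta_pos
  obtain ⟨l, hl⟩ := (h.lyapunov_tendsto hy).1
  obtain ⟨B, hB⟩ := hl.bddAbove_range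
  refine ⟨Real.sqrt (B / ((2 - 3 * μ) / (4 * μ * β))) + ‖y‖, fun k => ?_⟩
  have h1 : ‖z k - y‖ ^ 2 ≤ B / ((2 - 3 * μ) / (4 * μ * β)) := by
    rw [le_div_iff₀ (by positivity), mul_comm]
    exact (h.le_lyapunov hy k).trans (hB ⟨k, rfl⟩)
  have h2 := Real.le_sqrt_of_sq_le h1
  have h3 := norm_add_le (z k - y) y
  rw [sub_add_cancel] at h3
  linarith

theorem anchor_dist_step (h : IsTrajectory μ β βbar r G t η x z w) (hy : G y = 0) {M : ℝ}
    (k : ℕ) (hM : ‖z k - y‖ ≤ M) :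
    ‖z (k + 1) - y‖ ^ 2 ≤ ‖z k - y‖ ^ 2
      + (μ * β * (t k * ‖G (x k)‖ ^ 2 + ‖x k - z k‖ ^ 2 / t k)
        + μ * β * (t k ^ 2 * ‖w k‖ ^ 2 + M ^ 2 * (1 / (t k * (t k - 1))))
        + β ^ 2 * (t k * ‖G (x k) + w k‖ ^ 2)) := by
  have htk := h.t_pos k
  have htk1 : 0 < t k - 1 := by linarith [h.one_lt_t k]
  have hμ0 := h.mu_pos
  have hβ0 := h.beta_pos
  have e1 : ‖z (k + 1) - y‖ ^ 2 = ‖z k - y‖ ^ 2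
      - μ * η k * (⟪G (x k), (x k - z k) + (z k - y)⟫ - ⟪G (x k), x k - z k⟫ + ⟪w k, z k - y⟫)
      + (μ / 2 * η k) ^ 2 * ‖G (x k) + w k‖ ^ 2 := by
    have : z (k + 1) - y = (z k - y) - (μ / 2 * η k) • (G (x k) + w k) := by
      rw [h.z_succ]; module
    rw [this, norm_sub_sq_real, inner_smul_right, norm_smul, mul_pow, Real.norm_eq_abs, sq_abs,
      inner_add_right, inner_add_right, real_inner_comm, real_inner_comm (w k)]
    ring
  have h1 := (mul_nonneg (hβ0.le.trans h.le_betabar) (sq_nonneg _)).trans (h.coercive_sol hy k)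
  have hκ : 0 ≤ μ * η k := mul_nonneg hμ0.le (h.eta_nonneg k)
  have h2 := mul_nonneg hκ h1
  have hκ2 : μ * η k ≤ 2 * (μ * β) := by
    linarith [mul_le_mul_of_nonneg_left (h.eta_le k) hμ0.le]
  have h3 := inner_young htk hκ hκ2 (G (x k)) (-(x k - z k))
  have h4 := inner_young (mul_pos htk htk1) hκ hκ2 (w k) (z k - y)
  rw [inner_neg_right, norm_neg] at h3
  have h5 : ‖z k - y‖ ^ 2 ≤ M ^ 2 := pow_le_pow_left₀ (norm_nonneg _) hM 2
  have h6 : (μ / 2 * η k) ^ 2 * ‖G (x k) + w k‖ ^ 2 ≤ β ^ 2 * (t k * ‖G (x k) + w k‖ ^ 2) := by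
    have h7 : (μ / 2 * η k) ^ 2 ≤ β ^ 2 :=
      pow_le_pow_left₀ (by linarith) (by nlinarith [h.mu_lt]) 2
    have h8 : ‖G (x k) + w k‖ ^ 2 ≤ t k * ‖G (x k) + w k‖ ^ 2 :=
      le_mul_of_one_le_left (sq_nonneg _) (h.one_lt_t k).le
    gcongr
  have h7 : μ * β * (t k * (t k - 1) * ‖w k‖ ^ 2 + 1 / (t k * (t k - 1)) * ‖z k - y‖ ^ 2)
      ≤ μ * β * (t k ^ 2 * ‖w k‖ ^ 2 + M ^ 2 * (1 / (t k * (t k - 1)))) := by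
    rw [mul_comm (M ^ 2)]
    have : t k * (t k - 1) ≤ t k ^ 2 := by nlinarith
    gcongr
  have h8 : 1 / t k * ‖x k - z k‖ ^ 2 = ‖x k - z k‖ ^ 2 / t k := by ring
  rw [h8] at h3
  linarith

theorem anchor_dist_tendsto (h : IsTrajectory μ β βbar r G t η x z w) (hy : G y = 0) :
    ∃ l, Tendsto (fun k => ‖z k - y‖ ^ 2) atTop (nhds l) := by
  obtain ⟨M, hM⟩ := h.anchor_bounded hy
  refine (robbins_siegmund (V := fun k => ‖z k - y‖ ^ 2) (a := fun _ => 0) (R := fun _ => 0)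
    (b := fun k => μ * β * (t k * ‖G (x k)‖ ^ 2 + ‖x k - z k‖ ^ 2 / t k)
        + μ * β * (t k ^ 2 * ‖w k‖ ^ 2 + (M + ‖y‖) ^ 2 * (1 / (t k * (t k - 1))))
        + β ^ 2 * (t k * ‖G (x k) + w k‖ ^ 2))
    (fun k => sq_nonneg _) (fun _ => le_rfl) (fun k => ?_) (fun _ => le_rfl) summable_zero
    (((((h.lyapunov_tendsto hy).2.add (h.gap_tendsto hy).2).mul_left _).add
      ((h.summable_error.add (h.summable_inv.mul_left _)).mul_left _)).add
        ((h.summable_perturbed hy).mul_left _)) fun k => ?_).1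
  · have h1 := h.t_pos k
    have h2 : 0 < t k - 1 := by linarith [h.one_lt_t k]
    have h3 := h.mu_pos
    have h4 := h.beta_pos
    positivity
  · rw [add_zero, one_mul, sub_zero]
    exact h.anchor_dist_step hy k ((norm_sub_le _ _).trans (by gcongr; exact hM k))

theorem residual_bounded (h : IsTrajectory μ β βbar r G t η x z w) (hy : G y = 0) :
    ∃ B, ∀ k, (t k - μ) * ‖G (x k)‖ ≤ B := by
  have hβ0 := h.beta_pos
  obtain ⟨l, hl⟩ := (h.lyapunov_tendsto hy).1
  obtain ⟨l', hl'⟩ := h.anchor_dist_tendsto hy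
  obtain ⟨B, hB⟩ := (hl.add (hl'.const_mul (1 / (2 * β)))).bddAbove_range
  refine ⟨Real.sqrt (B / (β / 2)), fun k => Real.le_sqrt_of_sq_le ?_⟩
  rw [le_div_iff₀ (by positivity), mul_comm]
  exact (residual_sq_le_lyapunov h.mu_pos h.mu_lt hβ0 h.le_betabar (h.one_lt_t k)
    (h.coercive_sol hy k)).trans (hB ⟨k, rfl⟩)

theorem mul_le_t (h : IsTrajectory μ β βbar r G t η x z w) (k : ℕ) : μ * ((k : ℝ) + 1) ≤ t k := by
  have := one_add_le_weight h.mu_pos h.r_ge k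
  rw [h.t_eq]; linarith [h.mu_pos]

theorem inner_gap_tendsto (h : IsTrajectory μ β βbar r G t η x z w) (hy : G y = 0) :
    Tendsto (fun k => (t k - μ) * ⟪G (x k), x k - z k⟫) atTop (nhds 0) := by
  obtain ⟨B, hB⟩ := h.residual_bounded hy
  have h1 := ((h.gap_tendsto hy).1.norm).const_mul B
  rw [norm_zero, mul_zero] at h1
  refine squeeze_zero_norm (fun k => ?_) h1
  have hτ : 0 ≤ t k - μ := by linarith [h.one_lt_t k, h.mu_lt]
  rw [norm_mul, Real.norm_of_nonneg hτ]
  calc _ ≤ (t k - μ) * (‖G (x k)‖ * ‖x k - z k‖) := by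
        gcongr; exact norm_inner_le_norm _ _
    _ = (t k - μ) * ‖G (x k)‖ * ‖x k - z k‖ := by ring
    _ ≤ _ := by gcongr; exact hB k

theorem anchor_coeff_tendsto (h : IsTrajectory μ β βbar r G t η x z w) :
    Tendsto (fun k => (1 - μ) * (t k - μ / 2) / (2 * μ * β * (t k - 1))) atTop
      (nhds ((1 - μ) / (2 * μ * β))) := by
  have h1 : Tendsto (fun k => t k - 1) atTop atTop :=
    tendsto_atTop_add_const_right _ (-1) h.t_tendsto
  have h2 := ((h1.const_div_atTop (1 - μ / 2)).const_add 1).const_mul ((1 - μ) / (2 * μ * β))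
  rw [add_zero, mul_one] at h2
  refine h2.congr fun k => ?_
  have h3 : t k - 1 ≠ 0 := by linarith [h.one_lt_t k]
  have := h.mu_pos
  have := h.beta_pos
  field_simp
  ring

theorem sq_mul_residual_tendsto (h : IsTrajectory μ β βbar r G t η x z w) (hy : G y = 0) :
    Tendsto (fun k => t k ^ 2 * ‖G (x k)‖ ^ 2) atTop (nhds 0) := by
  have hβ0 := h.beta_pos
  have hμ0 := h.mu_pos
  obtain ⟨⟨l, hl⟩, hs⟩ := h.lyapunov_tendsto hy
  obtain ⟨l', hl'⟩ := h.anchor_dist_tendsto hy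
  have hτ : ∀ k : ℕ, μ * ((k : ℝ) + 1) ≤ t k - μ - 1 := fun k => by
    have := one_add_le_weight hμ0 h.r_ge k
    rw [h.t_eq]; linarith
  have hτ0 : ∀ k : ℕ, 0 < t k - μ - 1 := fun k =>
    lt_of_lt_of_le (by positivity) (hτ k)
  have hA0 : ∀ k, 0 ≤ β * ((t k - μ) * (t k - μ - 1)) * ‖G (x k)‖ ^ 2 := fun k =>
    mul_nonneg (mul_nonneg hβ0.le (mul_nonneg (by linarith [hτ0 k]) (hτ0 k).le)) (sq_nonneg _)
  have hA := (hl.sub (h.inner_gap_tendsto hy)).sub (h.anchor_coeff_tendsto.mul hl')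
  have hA1 : Tendsto (fun k => β * ((t k - μ) * (t k - μ - 1)) * ‖G (x k)‖ ^ 2) atTop
      (nhds (l - 0 - (1 - μ) / (2 * μ * β) * l')) :=
    hA.congr fun k => by unfold lyapunov; ring
  have hA2 := tendsto_zero_of_summable_div hA0 hA1 h.t_pos h.t_le
    ((hs.mul_left β).of_nonneg_of_le (fun k => div_nonneg (hA0 k) (h.t_pos k).le) fun k => by
      rw [div_le_iff₀ (h.t_pos k)]
      have : (t k - μ) * (t k - μ - 1) ≤ t k * t k :=
        mul_le_mul (by linarith) (by linarith) (hτ0 k).le (h.t_pos k).le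
      calc _ ≤ β * (t k * t k) * ‖G (x k)‖ ^ 2 := by gcongr
        _ = _ := by ring)
  have hA3 := hA2.const_mul (r ^ 2 / β)
  rw [mul_zero] at hA3
  refine squeeze_zero (fun k => by positivity) (fun k => ?_) hA3
  have hr : 0 ≤ r := by
    have := h.r_ge
    have : 0 < 1 / μ := by positivity
    linarith
  have h1 : t k ≤ r * (t k - μ - 1) := by
    calc _ ≤ r * (μ * ((k : ℝ) + 1)) := (h.t_le k).trans_eq (by ring)
      _ ≤ _ := by gcongr; exact hτ k
  have h2 : t k ≤ r * (t k - μ) := h1.trans (mul_le_mul_of_nonneg_left (by linarith) hr)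
  have h3 : t k ^ 2 ≤ r * (t k - μ) * (r * (t k - μ - 1)) := by
    rw [sq]; exact mul_le_mul h2 h1 (h.t_pos k).le ((h.t_pos k).le.trans h2)
  calc _ ≤ r * (t k - μ) * (r * (t k - μ - 1)) * ‖G (x k)‖ ^ 2 := by gcongr
    _ = _ := by field_simp

theorem sq_mul_perturbed_tendsto (h : IsTrajectory μ β βbar r G t η x z w) (hy : G y = 0) :
    Tendsto (fun k => t k ^ 2 * ‖G (x k) + w k‖ ^ 2) atTop (nhds 0) := by
  have h1 := ((h.sq_mul_residual_tendsto hy).add h.summable_error.tendsto_atTop_zero).const_mul 2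
  rw [add_zero, mul_zero] at h1
  refine squeeze_zero (fun k => by positivity) (fun k => ?_) h1
  have := mul_le_mul_of_nonneg_left (norm_add_sq_le_two_mul (G (x k)) (w k)) (sq_nonneg (t k))
  linarith

theorem sq_mul_step_le (h : IsTrajectory μ β βbar r G t η x z w) (k : ℕ) :
    t k ^ 2 * ‖x (k + 1) - x k‖ ^ 2
      ≤ 2 * (‖x k - z k‖ ^ 2 + 4 * β ^ 2 * (t k ^ 2 * ‖G (x k) + w k‖ ^ 2)) := by
  have ht := h.t_pos k
  have h1 : t k • (x (k + 1) - x k) = -((x k - z k) + (t k * η k) • (G (x k) + w k)) := by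
    have h2 : x k - (1 / t k) • (x k - z k) - η k • (G (x k) + w k) - x k
        = -((1 / t k) • (x k - z k) + η k • (G (x k) + w k)) := by abel
    rw [h.x_succ k, h2, smul_neg, smul_add, smul_smul, smul_smul, mul_one_div_cancel ht.ne',
      one_smul]
  have h2 : t k ^ 2 * ‖x (k + 1) - x k‖ ^ 2
      = ‖(x k - z k) + (t k * η k) • (G (x k) + w k)‖ ^ 2 := by
    rw [← norm_neg (_ + _), ← h1, norm_smul, mul_pow, Real.norm_eq_abs, sq_abs]
  have h3 : (t k * η k) ^ 2 ≤ 4 * β ^ 2 * t k ^ 2 := by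
    have := pow_le_pow_left₀ (h.eta_nonneg k) (h.eta_le k) 2
    rw [mul_pow]
    nlinarith [sq_nonneg (t k)]
  have h4 := norm_add_sq_le_two_mul (x k - z k) ((t k * η k) • (G (x k) + w k))
  rw [norm_smul, mul_pow, Real.norm_eq_abs, sq_abs] at h4
  have h5 := mul_le_mul_of_nonneg_right h3 (sq_nonneg ‖G (x k) + w k‖)
  linarith

theorem sq_mul_step_tendsto (h : IsTrajectory μ β βbar r G t η x z w) (hy : G y = 0) :
    Tendsto (fun k => t k ^ 2 * ‖x (k + 1) - x k‖ ^ 2) atTop (nhds 0) := by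
  have h1 := (((h.gap_tendsto hy).1.norm.pow 2).add
    ((h.sq_mul_perturbed_tendsto hy).const_mul (4 * β ^ 2))).const_mul 2
  simp only [norm_zero, mul_zero, add_zero, ne_eq, OfNat.ofNat_ne_zero, not_false_eq_true,
    zero_pow] at h1
  exact squeeze_zero (fun k => by positivity) h.sq_mul_step_le h1

theorem summable_step (h : IsTrajectory μ β βbar r G t η x z w) (hy : G y = 0) :
    Summable fun k => t k * ‖x (k + 1) - x k‖ ^ 2 := by
  refine (((h.gap_tendsto hy).2.add
    ((h.summable_perturbed hy).mul_left (4 * β ^ 2))).mul_left 2).of_nonneg_of_le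
    (fun k => mul_nonneg (h.t_pos k).le (sq_nonneg _)) fun k => ?_
  have ht := h.t_pos k
  refine le_of_mul_le_mul_left ?_ ht
  calc t k * (t k * ‖x (k + 1) - x k‖ ^ 2) = t k ^ 2 * ‖x (k + 1) - x k‖ ^ 2 := by ring
    _ ≤ _ := h.sq_mul_step_le k
    _ = _ := by field_simp

theorem exists_limit [ProperSpace E] (h : IsTrajectory μ β βbar r G t η x z w)
    (hG : Continuous G) (hy : G y = 0) :
    ∃ xbar, G xbar = 0 ∧ Tendsto x atTop (nhds xbar) ∧ Tendsto z atTop (nhds xbar) := by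
  obtain ⟨M, hM⟩ := h.anchor_bounded hy
  obtain ⟨xbar, -, φ, hφ, hzφ⟩ := tendsto_subseq_of_bounded (x := z)
    (Metric.isBounded_closedBall (x := (0 : E)) (r := M)) fun k => by simpa using hM k
  have hgap := (h.gap_tendsto hy).1
  have hxφ : Tendsto (x ∘ φ) atTop (nhds xbar) := by
    simpa [Function.comp_def] using (hgap.comp hφ.tendsto_atTop).add hzφ
  have hg : Tendsto (fun k => G (x k)) atTop (nhds 0) := by
    have h1 := (h.sq_mul_residual_tendsto hy).sqrt
    rw [Real.sqrt_zero] at h1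
    refine squeeze_zero_norm (fun k => ?_) h1
    refine Real.le_sqrt_of_sq_le (le_mul_of_one_le_left (sq_nonneg _) ?_)
    exact one_le_pow₀ (h.one_lt_t k).le
  have hbar : G xbar = 0 :=
    tendsto_nhds_unique ((hG.tendsto xbar).comp hxφ) (hg.comp hφ.tendsto_atTop)
  obtain ⟨l, hl⟩ := h.anchor_dist_tendsto hbar
  have h0 : Tendsto (fun k => ‖z (φ k) - xbar‖ ^ 2) atTop (nhds 0) := by
    simpa using (((hzφ.sub_const xbar).norm).pow 2)
  have hl0 : l = 0 := tendsto_nhds_unique (hl.comp hφ.tendsto_atTop) h0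
  subst hl0
  have hz : Tendsto z atTop (nhds xbar) := by
    rw [tendsto_iff_norm_sub_tendsto_zero]
    simpa using hl.sqrt
  refine ⟨xbar, hbar, ?_, hz⟩
  simpa using hgap.add hz

theorem summable_natCast_mul (h : IsTrajectory μ β βbar r G t η x z w) (m : ℕ) {a : ℕ → ℝ}
    (ha : ∀ k, 0 ≤ a k) (hs : Summable fun k => t k ^ m * a k) :
    Summable fun k : ℕ => ((k : ℝ) + 1) ^ m * a k := by
  have hμ0 := h.mu_pos
  refine (hs.mul_left (1 / μ ^ m)).of_nonneg_of_le
    (fun k => mul_nonneg (by positivity) (ha k)) fun k => ?_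
  have h1 := pow_le_pow_left₀ (by positivity) (h.mul_le_t k) m
  rw [mul_pow] at h1
  have := mul_le_mul_of_nonneg_right h1 (ha k)
  rw [one_div_mul_eq_div, le_div_iff₀ (by positivity)]
  linarith

theorem tendsto_natCast_sq_mul (h : IsTrajectory μ β βbar r G t η x z w) {a : ℕ → ℝ}
    (ha : ∀ k, 0 ≤ a k) (hs : Tendsto (fun k => t k ^ 2 * a k) atTop (nhds 0)) :
    Tendsto (fun k : ℕ => (k : ℝ) ^ 2 * a k) atTop (nhds 0) := by
  have hμ0 := h.mu_pos
  have h0 := hs.const_mul (1 / μ ^ 2)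
  rw [mul_zero] at h0
  refine squeeze_zero (fun k => mul_nonneg (by positivity) (ha k)) (fun k => ?_) h0
  have h1 := pow_le_pow_left₀ (by positivity) (h.mul_le_t k) 2
  have h2 : (μ * (k : ℝ)) ^ 2 ≤ (μ * ((k : ℝ) + 1)) ^ 2 := by gcongr; linarith
  have := mul_le_mul_of_nonneg_right (h2.trans h1) (ha k)
  rw [one_div_mul_eq_div, le_div_iff₀ (by positivity)]
  linarith

end IsTrajectory

end Pathwise

section ForwardBackward

variable {E : Type*} [NormedAddCommGroup E] [InnerProductSpace ℝ E]

theorem norm_sub_le_of_cocoercive {c : ℝ} (hc : 0 < c) {F : E → E}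
    (hF : ∀ a b, c * ‖F a - F b‖ ^ 2 ≤ ⟪F a - F b, a - b⟫) (a b : E) :
    ‖F a - F b‖ ≤ 1 / c * ‖a - b‖ := by
  rw [one_div_mul_eq_div, le_div_iff₀ hc]
  rcases (norm_nonneg (F a - F b)).eq_or_lt with h | h
  · rw [← h, zero_mul]; positivity
  · refine le_of_mul_le_mul_left ?_ h
    have := (hF a b).trans (real_inner_le_norm _ _)
    linarith

theorem continuous_of_cocoercive {c : ℝ} (hc : 0 < c) {F : E → E}
    (hF : ∀ a b, c * ‖F a - F b‖ ^ 2 ≤ ⟪F a - F b, a - b⟫) : Continuous F :=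
  (LipschitzWith.of_dist_le_mul (K := ⟨1 / c, by positivity⟩) fun a b => by
    rw [dist_eq_norm, dist_eq_norm]; exact norm_sub_le_of_cocoercive hc hF a b).continuous

theorem resolvent_nonexpansive {ρ lam : ℝ} (hlam0 : 0 < lam) (hlam : 2 * ρ ≤ lam) {T : E → Set E}
    (hT : ∀ a b u v, u ∈ T a → v ∈ T b → ⟪u - v, a - b⟫ ≥ -ρ * ‖u - v‖ ^ 2)
    {J : E → E} (hJ : ∀ a, a - J a ∈ lam • T (J a)) (a b : E) : ‖J a - J b‖ ≤ ‖a - b‖ := by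
  obtain ⟨u, hu, hua⟩ := hJ a
  obtain ⟨v, hv, hvb⟩ := hJ b
  have h1 := hT _ _ u v hu hv
  have hd : a - b = (J a - J b) + lam • (u - v) := by
    rw [smul_sub]
    simp only at hua hvb
    rw [hua, hvb]; abel
  refine le_of_sq_le_sq ?_ (norm_nonneg _)
  rw [hd, norm_add_sq_real, inner_smul_right, norm_smul, mul_pow, Real.norm_eq_abs, sq_abs,
    real_inner_comm]
  nlinarith [mul_nonneg (mul_nonneg hlam0.le (sub_nonneg.2 hlam)) (sq_nonneg ‖u - v‖),
    mul_le_mul_of_nonneg_left h1 hlam0.le]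

theorem residual_cocoercive {L ρ Lhat lam βbar Λ : ℝ} (hL : 0 < L) (hLhat : L < Lhat)
    (hLhatρ : Lhat * ρ < 1) (hlam0 : 0 < lam)
    {F : E → E} (hF : ∀ a b, ⟪F a - F b, a - b⟫ ≥ (1 / L) * ‖F a - F b‖ ^ 2) {T : E → Set E}
    (hT : ∀ a b u v, u ∈ T a → v ∈ T b → ⟪u - v, a - b⟫ ≥ -ρ * ‖u - v‖ ^ 2)
    {J : E → E} (hJ : ∀ a, a - J a ∈ lam • T (J a)) {G : E → E}
    (hG : ∀ a, G a = (1 / lam) • (a - J (a - lam • F a)))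
    (hβbar : βbar = (lam * (4 - Lhat * lam) - 4 * ρ) / (4 * (1 - ρ * Lhat)))
    (hΛ : Λ = (Lhat - L) / (L * Lhat)) (a b : E) :
    βbar * ‖G a - G b‖ ^ 2 + Λ * (L * ⟪F a - F b, a - b⟫) ≤ ⟪G a - G b, a - b⟫ := by
  have hmem : ∀ a, J (a - lam • F a) = a - lam • G a ∧ G a - F a ∈ T (J (a - lam • F a)) := by
    intro a
    have h1 : lam • G a = a - J (a - lam • F a) := by
      rw [hG, smul_smul, mul_one_div_cancel hlam0.ne', one_smul]
    refine ⟨by rw [h1]; abel, ?_⟩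
    obtain ⟨u, hu, hua⟩ := hJ (a - lam • F a)
    have h2 : lam • u = lam • (G a - F a) := by
      rw [smul_sub, h1]; simp only at hua; rw [hua]; abel
    rwa [← smul_right_injective E hlam0.ne' h2]
  have h1 := hT _ _ _ _ (hmem a).2 (hmem b).2
  rw [(hmem a).1, (hmem b).1] at h1
  have h2 := hF a b
  have e1 : G a - F a - (G b - F b) = (G a - G b) - (F a - F b) := by abel
  have e2 : a - lam • G a - (b - lam • G b) = (a - b) - lam • (G a - G b) := by
    rw [smul_sub]; abel
  rw [e1, e2] at h1
  generalize G a - G b = g at *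
  generalize F a - F b = f at *
  generalize a - b = d at *
  rw [norm_sub_sq_real, inner_sub_left, inner_sub_right, inner_sub_right, inner_smul_right,
    inner_smul_right, real_inner_self_eq_norm_sq, real_inner_comm f g] at h1
  have hLh : 0 < Lhat := hL.trans hLhat
  have hc : 0 < 1 - ρ * Lhat := by linarith
  have h3 : 0 ≤ ‖(1 - ρ * Lhat) • f - (Lhat * (lam / 2 - ρ)) • g‖ ^ 2 := sq_nonneg _
  rw [norm_sub_sq_real, norm_smul, norm_smul, inner_smul_left, inner_smul_right, mul_pow, mul_pow,
    Real.norm_eq_abs, Real.norm_eq_abs, sq_abs, sq_abs, RCLike.conj_to_real] at h3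
  have h4 : L / Lhat * ⟪f, d⟫ ≥ 1 / Lhat * ‖f‖ ^ 2 := by
    calc _ ≥ L / Lhat * (1 / L * ‖f‖ ^ 2) := mul_le_mul_of_nonneg_left h2 (by positivity)
      _ = _ := by field_simp
  have h5 : Λ * (L * ⟪f, d⟫) = ⟪f, d⟫ - L / Lhat * ⟪f, d⟫ := by
    rw [hΛ]; field_simp
  have h6 : (lam - ρ - βbar) * ‖g‖ ^ 2 - (lam - 2 * ρ) * ⟪f, g⟫ + (1 / Lhat - ρ) * ‖f‖ ^ 2
      = 1 / (Lhat * (1 - ρ * Lhat)) * ((1 - ρ * Lhat) ^ 2 * ‖f‖ ^ 2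
        - 2 * ((1 - ρ * Lhat) * (Lhat * (lam / 2 - ρ) * ⟪f, g⟫))
        + (Lhat * (lam / 2 - ρ)) ^ 2 * ‖g‖ ^ 2) := by
    rw [hβbar]; field_simp; ring
  have h7 := mul_nonneg (one_div_nonneg.2 (mul_pos hLh hc).le) h3
  rw [← h6] at h7
  linarith

theorem norm_residual_sub_le {ρ lam : ℝ} (hlam0 : 0 < lam) (hlam : 2 * ρ ≤ lam) {T : E → Set E}
    (hT : ∀ a b u v, u ∈ T a → v ∈ T b → ⟪u - v, a - b⟫ ≥ -ρ * ‖u - v‖ ^ 2)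
    {J : E → E} (hJ : ∀ a, a - J a ∈ lam • T (J a)) (a u v : E) :
    ‖(1 / lam) • (a - J (a - lam • u)) - (1 / lam) • (a - J (a - lam • v))‖ ≤ ‖u - v‖ := by
  have h1 := resolvent_nonexpansive hlam0 hlam hT hJ (a - lam • v) (a - lam • u)
  have h2 : a - lam • v - (a - lam • u) = lam • (u - v) := by rw [smul_sub]; abel
  rw [h2, norm_smul, Real.norm_of_nonneg hlam0.le] at h1
  rw [← smul_sub, sub_sub_sub_cancel_left, norm_smul, Real.norm_of_nonneg (by positivity),
    one_div_mul_eq_div, div_le_iff₀ hlam0]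
  linarith

end ForwardBackward

section Stochastic

theorem ae_summable_of_summable_integral {Ω : Type*} {m0 : MeasurableSpace Ω} {ℙ : Measure Ω}
    {f : ℕ → Ω → ℝ} (h0 : ∀ k, 0 ≤ᵐ[ℙ] f k) (hi : ∀ k, Integrable (f k) ℙ)
    (hs : Summable fun k => ∫ ω, f k ω ∂ℙ) : ∀ᵐ ω ∂ℙ, Summable fun k => f k ω := by
  have h1 : ∀ k, eLpNorm (f k) 1 ℙ = ENNReal.ofReal (∫ ω, f k ω ∂ℙ) := fun k => by
    rw [eLpNorm_one_eq_lintegral_enorm, ← ofReal_integral_norm_eq_lintegral_enorm (hi k)]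
    congr 1
    refine integral_congr_ae ?_
    filter_upwards [h0 k] with ω hω using Real.norm_of_nonneg hω
  filter_upwards [summable_norm_of_tsum_eLpNorm_ne_top le_rfl
    (fun k => (hi k).aestronglyMeasurable) (by simp_rw [h1]; exact hs.tsum_ofReal_ne_top)]
    with ω hω using hω.of_norm

/-- The expected errors are summable when the expected energy and the variance proxy `φ` obey
coupled recursions whose cross terms cancel. -/
theorem summable_of_coupled_recursion {v φ ε a s τ τ' Γ : ℕ → ℝ} {c Λ : ℝ} (hc : 0 < c)
    (hv : ∀ k, 0 ≤ v k) (hφ : ∀ k, 0 ≤ φ k) (hτ : ∀ k, 0 ≤ τ k) (hτ' : ∀ k, 0 ≤ τ' k)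
    (hττ' : ∀ k, τ' (k + 1) = τ k) (hΓ : ∀ k, 0 ≤ Γ k) (ha : ∀ k, 0 ≤ a k) (hs : ∀ k, 0 ≤ s k)
    (hsa : Summable a) (hss : Summable s)
    (hstep : ∀ᶠ k in atTop,
      v (k + 1) ≤ (1 + a k) * v k - Λ * (τ k * ε (k + 1)) + 3 * c * (τ k * φ k))
    (hvar : ∀ k, Γ (k + 1) * τ k * φ (k + 1)
      ≤ (Γ k * τ' k - 5 * c * τ k) * φ k + Λ * (τ k * ε (k + 1)) + s k) :
    Summable fun k => τ k * φ k := by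
  obtain ⟨N, hN⟩ := eventually_atTop.1 hstep
  have h1 := (robbins_siegmund (V := fun k => v (k + N) + Γ (k + N) * τ' (k + N) * φ (k + N))
    (a := fun k => a (k + N)) (R := fun k => 2 * c * (τ (k + N) * φ (k + N)))
    (b := fun k => s (k + N))
    (fun k => add_nonneg (hv _) (mul_nonneg (mul_nonneg (hΓ _) (hτ' _)) (hφ _)))
    (fun k => ha _) (fun k => hs _)
    (fun k => mul_nonneg (by positivity) (mul_nonneg (hτ _) (hφ _)))
    ((summable_nat_add_iff N).2 hsa) ((summable_nat_add_iff N).2 hss) fun k => by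
      have h1 := hN (k + N) (by lia)
      have h2 := hvar (k + N)
      have h3 := mul_nonneg (ha (k + N))
        (mul_nonneg (mul_nonneg (hΓ (k + N)) (hτ' (k + N))) (hφ (k + N)))
      rw [show k + 1 + N = k + N + 1 by ring, hττ']
      linarith).2
  exact (summable_nat_add_iff N).1 ((summable_mul_left_iff (by positivity : 2 * c ≠ 0)).1 h1)

variable {Ω : Type*} {m0 : MeasurableSpace Ω} {ℙ : Measure Ω}
  {E : Type*} [NormedAddCommGroup E] [InnerProductSpace ℝ E]

theorem integrable_lyapunov {μ β t : ℝ} {g D u : Ω → E} (hg : MemLp g 2 ℙ) (hD : MemLp D 2 ℙ)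
    (hu : MemLp u 2 ℙ) : Integrable (fun ω => lyapunov μ β t (g ω) (D ω) (u ω)) ℙ := by
  have h1 : ∀ {f : Ω → E}, MemLp f 2 ℙ → Integrable (fun ω => ‖f ω‖ ^ 2) ℙ := fun hf =>
    (memLp_two_iff_integrable_sq_norm hf.1).1 hf
  have h2 : Integrable (fun ω => ⟪g ω, D ω⟫) ℙ :=
    ((h1 hg).add (h1 hD)).mono' (hg.1.inner hD.1) <| ae_of_all _ fun ω => by
      have h3 := norm_inner_le_norm (𝕜 := ℝ) (g ω) (D ω)
      have := two_mul_le_add_sq ‖g ω‖ ‖D ω‖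
      have := mul_nonneg (norm_nonneg (g ω)) (norm_nonneg (D ω))
      simp only [Pi.add_apply]
      linarith
  exact (((h1 hg).const_mul _).add (h2.const_mul _)).add ((h1 hu).const_mul _)

theorem memLp_gap {x z w : ℕ → Ω → E} {G : E → E} {t c : ℕ → ℝ}
    (h0 : ∀ ω, x 0 ω = z 0 ω) (hg : ∀ k, MemLp (fun ω => G (x k ω)) 2 ℙ)
    (hw : ∀ k, MemLp (w k) 2 ℙ)
    (hD : ∀ᵐ ω ∂ℙ, ∀ k, x (k + 1) ω - z (k + 1) ω
      = x k ω - z k ω - (1 / t k) • (x k ω - z k ω) - c k • (G (x k ω) + w k ω)) (k : ℕ) :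
    MemLp (fun ω => x k ω - z k ω) 2 ℙ := by
  induction k with
  | zero => simp [h0]
  | succ k ih =>
    refine (memLp_congr_ae ?_).2
      ((ih.sub (ih.const_smul (1 / t k))).sub (((hg k).add (hw k)).const_smul (c k)))
    filter_upwards [hD] with ω hω using hω k

theorem integral_lyapunov_succ_le {E : Type*} [NormedAddCommGroup E] [InnerProductSpace ℝ E]
    {μ β βbar t η : ℝ} {G : E → E} {x x' z z' w : Ω → E} {e : Ω → ℝ} {xstar : E}
    (hμ0 : 0 < μ) (hμ1 : μ < 2 / 3) (hβ0 : 0 < β) (hβ : β * (2 + μ) ≤ (2 - μ) * βbar)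
    (ht : 2 + 12 / (2 - 3 * μ) ≤ t) (hη : η = 2 * β * (t - 1) / (t - μ / 2))
    (hG : ∀ a b, βbar * ‖G a - G b‖ ^ 2 ≤ ⟪G a - G b, a - b⟫) (hxs : G xstar = 0)
    (hx : ∀ᵐ ω ∂ℙ, x' ω = x ω - (1 / t) • (x ω - z ω) - η • (G (x ω) + w ω))
    (hz : ∀ᵐ ω ∂ℙ, z' ω = z ω - (μ / 2 * η) • (G (x ω) + w ω))
    (hcoc : ∀ᵐ ω ∂ℙ,
      βbar * ‖G (x' ω) - G (x ω)‖ ^ 2 + e ω ≤ ⟪G (x' ω) - G (x ω), x' ω - x ω⟫)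
    (hg : MemLp (fun ω => G (x ω)) 2 ℙ) (hg' : MemLp (fun ω => G (x' ω)) 2 ℙ)
    (hD : MemLp (fun ω => x ω - z ω) 2 ℙ) (hD' : MemLp (fun ω => x' ω - z' ω) 2 ℙ)
    (hu : MemLp (fun ω => z ω - xstar) 2 ℙ) (hu' : MemLp (fun ω => z' ω - xstar) 2 ℙ)
    (hw : MemLp w 2 ℙ) (he : Integrable e ℙ) :
    ∫ ω, lyapunov μ β (t + μ) (G (x' ω)) (x' ω - z' ω) (z' ω - xstar) ∂ℙ
      ≤ (1 + μ ^ 2 / (2 - 3 * μ) * (1 / (t * (t - 1))))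
          * ∫ ω, lyapunov μ β t (G (x ω)) (x ω - z ω) (z ω - xstar) ∂ℙ
        - t * (t - 1) * ∫ ω, e ω ∂ℙ + 3 * β / μ * (t * (t - 1)) * ∫ ω, ‖w ω‖ ^ 2 ∂ℙ := by
  have i1 := integrable_lyapunov (μ := μ) (β := β) (t := t) hg hD hu
  have i2 := integrable_lyapunov (μ := μ) (β := β) (t := t + μ) hg' hD' hu'
  have i3 := (memLp_two_iff_integrable_sq_norm hw.1).1 hw
  rw [← integral_const_mul, ← integral_const_mul, ← integral_const_mul,
    ← integral_sub' (i1.const_mul _) (he.const_mul _),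
    ← integral_add' ((i1.const_mul _).sub (he.const_mul _)) (i3.const_mul _)]
  refine integral_mono_ae i2 (((i1.const_mul _).sub (he.const_mul _)).add (i3.const_mul _)) ?_
  filter_upwards [hx, hz, hcoc] with ω h1 h2 h3
  have h4 := lyapunov_iterate_le hμ0 hμ1 hβ0 hβ ht hη hG hxs h1 h2 h3
  have h5 : 0 ≤ β * (2 - 3 * μ) / 4 * t * ‖G (x ω)‖ ^ 2 := by
    have hm : 0 < 2 - 3 * μ := by linarith
    have : 0 < t := lt_of_lt_of_le (by positivity) ht
    positivity
  simp only [Pi.add_apply, Pi.sub_apply]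
  linarith

theorem integral_le_of_condExp_le [IsProbabilityMeasure ℙ] {m : MeasurableSpace Ω} (hm : m ≤ m0)
    {f g : Ω → ℝ} (hg : Integrable g ℙ) (h : ℙ[f|m] ≤ᵐ[ℙ] g) : ∫ ω, f ω ∂ℙ ≤ ∫ ω, g ω ∂ℙ := by
  rw [← integral_condExp hm]
  exact integral_mono_ae integrable_condExp hg h

theorem integral_le_of_condExp_le_condExp [IsProbabilityMeasure ℙ] {m : MeasurableSpace Ω}
    (hm : m ≤ m0) {f g : Ω → ℝ} (h : ℙ[f|m] ≤ᵐ[ℙ] ℙ[g|m]) : ∫ ω, f ω ∂ℙ ≤ ∫ ω, g ω ∂ℙ := by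
  rw [← integral_condExp hm (f := g)]
  exact integral_le_of_condExp_le hm integrable_condExp h

theorem integral_le_of_condExp_le_affine [IsProbabilityMeasure ℙ] {m : MeasurableSpace Ω}
    (hm : m ≤ m0) {f g h : Ω → ℝ} {a b c : ℝ} (hg : Integrable g ℙ) (hh : Integrable h ℙ)
    (hf : ℙ[f|m] ≤ᵐ[ℙ] fun ω => a * g ω + b * h ω + c) :
    ∫ ω, f ω ∂ℙ ≤ a * ∫ ω, g ω ∂ℙ + b * ∫ ω, h ω ∂ℙ + c := by
  have i1 := hg.const_mul a
  have i2 := hh.const_mul b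
  refine (integral_le_of_condExp_le hm ((i1.add i2).add (integrable_const c)) hf).trans_eq ?_
  rw [integral_add' (i1.add i2) (integrable_const _), integral_add' i1 i2, integral_const_mul,
    integral_const_mul]
  simp

/-- The integrated recursion for the variance proxy, after weighting by `Γ τ`. -/
theorem weighted_variance_step {φ φ' ε κ Θ σ Γ Γ' τ τ' c Λ : ℝ} (hφ : 0 ≤ φ) (hε : 0 ≤ ε)
    (hτ : 0 < τ) (hΓ' : 0 < Γ') (hΘ : 0 < Θ)
    (h : φ' ≤ (1 - κ) * φ + Θ * ε + σ ^ 2)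
    (hκ : 1 - Γ * τ' / (Γ' * τ) + 5 * c / Γ' ≤ κ) (hΓΘ : Γ' * Θ ≤ Λ) :
    Γ' * τ * φ' ≤ (Γ * τ' - 5 * c * τ) * φ + Λ * (τ * ε) + Λ * (τ * σ ^ 2 / Θ) := by
  have hτΓ := mul_pos hΓ' hτ
  have h1 := mul_le_mul_of_nonneg_left h hτΓ.le
  have h2 : Γ' * τ * (1 - κ) ≤ Γ * τ' - 5 * c * τ := by
    calc _ ≤ Γ' * τ * (Γ * τ' / (Γ' * τ) - 5 * c / Γ') :=
        mul_le_mul_of_nonneg_left (by linarith) hτΓ.le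
      _ = _ := by field_simp
  have h3 := mul_le_mul_of_nonneg_right h2 hφ
  have h4 := mul_le_mul_of_nonneg_right hΓΘ (mul_nonneg hτ.le hε)
  have h5 : Γ' * τ * σ ^ 2 ≤ Λ * (τ * σ ^ 2 / Θ) := by
    calc _ = Γ' * Θ * (τ * σ ^ 2 / Θ) := by field_simp
      _ ≤ _ := by gcongr
  linarith

/-- The weighted expected variance proxies of VFOSA₊ are summable. -/
theorem summable_weighted_variance {E : Type*} [NormedAddCommGroup E] [InnerProductSpace ℝ E]
    {μ β βbar r Λ : ℝ} {G : E → E} {x z w : ℕ → Ω → E} {Ebar : ℕ → Ω → ℝ} {xstar : E}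
    {t η φ κ Θ σ' Γ : ℕ → ℝ}
    (hμ0 : 0 < μ) (hμ1 : μ < 2 / 3) (hβ0 : 0 < β) (hβ : β * (2 + μ) ≤ (2 - μ) * βbar)
    (hr : 2 + 1 / μ ≤ r) (hΛ0 : 0 ≤ Λ) (ht : ∀ k : ℕ, t k = μ * ((k : ℝ) + r))
    (hη : ∀ k, η k = 2 * β * (t k - 1) / (t k - μ / 2))
    (hG : ∀ a b, βbar * ‖G a - G b‖ ^ 2 ≤ ⟪G a - G b, a - b⟫) (hxs : G xstar = 0)
    (hxz : ∀ᵐ ω ∂ℙ, ∀ k,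
      x (k + 1) ω = x k ω - (1 / t k) • (x k ω - z k ω) - η k • (G (x k ω) + w k ω)
      ∧ z (k + 1) ω = z k ω - (μ / 2 * η k) • (G (x k ω) + w k ω))
    (hres : ∀ k, ∀ᵐ ω ∂ℙ,
      βbar * ‖G (x (k + 1) ω) - G (x k ω)‖ ^ 2 + Λ * Ebar (k + 1) ω
        ≤ ⟪G (x (k + 1) ω) - G (x k ω), x (k + 1) ω - x k ω⟫)
    (hgL : ∀ k, MemLp (fun ω => G (x k ω)) 2 ℙ) (hDL : ∀ k, MemLp (fun ω => x k ω - z k ω) 2 ℙ)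
    (huL : ∀ k, MemLp (fun ω => z k ω - xstar) 2 ℙ) (hwL : ∀ k, MemLp (w k) 2 ℙ)
    (hε : ∀ k, Integrable (Ebar k) ℙ) (hε0 : ∀ k, 0 ≤ ∫ ω, Ebar k ω ∂ℙ) (hφ0 : ∀ k, 0 ≤ φ k)
    (hwφ : ∀ k, ∫ ω, ‖w k ω‖ ^ 2 ∂ℙ ≤ φ k)
    (hφ : ∀ k, φ (k + 1)
      ≤ (1 - κ (k + 1)) * φ k + Θ (k + 1) * ∫ ω, Ebar (k + 1) ω ∂ℙ + σ' (k + 1) ^ 2)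
    (hΓ : ∀ k, 0 < Γ k) (hΘ : ∀ k, 0 < Θ k)
    (hκ : ∀ k, 1 - Γ k * ((t k - μ) * (t k - μ - 1)) / (Γ (k + 1) * (t k * (t k - 1)))
      + 5 * (β / μ) / Γ (k + 1) ≤ κ (k + 1))
    (hΓΘ : ∀ k, Γ k * Θ k ≤ Λ)
    (hσ : Summable fun k => t k * (t k - 1) * σ' (k + 1) ^ 2 / Θ (k + 1)) :
    Summable fun k => t k * (t k - 1) * φ k := by
  have ht1 : ∀ k, 1 + 2 * μ ≤ t k := fun k => by
    rw [ht]; linarith [one_add_le_weight hμ0 hr k, (by positivity : 0 ≤ μ * (k : ℝ))]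
  have hτ0 : ∀ k, 0 < t k * (t k - 1) := fun k =>
    mul_pos (by linarith [ht1 k]) (by linarith [ht1 k])
  refine summable_of_coupled_recursion (τ := fun k => t k * (t k - 1))
    (v := fun k => ∫ ω, lyapunov μ β (t k) (G (x k ω)) (x k ω - z k ω) (z k ω - xstar) ∂ℙ)
    (ε := fun k => ∫ ω, Ebar k ω ∂ℙ) (Γ := Γ) (c := β / μ) (Λ := Λ)
    (τ' := fun k => (t k - μ) * (t k - μ - 1))
    (a := fun k => μ ^ 2 / (2 - 3 * μ) * (1 / (t k * (t k - 1))))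
    (s := fun k => Λ * (t k * (t k - 1) * σ' (k + 1) ^ 2 / Θ (k + 1)))
    (div_pos hβ0 hμ0) (fun k => integral_nonneg fun ω => ?_) hφ0 (fun k => (hτ0 k).le)
    (fun k => mul_nonneg (by linarith [ht1 k]) (by linarith [ht1 k])) (fun k => ?_)
    (fun k => (hΓ k).le)
    (fun k => mul_nonneg (div_nonneg (sq_nonneg _) (by linarith)) (one_div_pos.2 (hτ0 k)).le)
    (fun k => mul_nonneg hΛ0
      (div_nonneg (mul_nonneg (hτ0 k).le (sq_nonneg _)) (hΘ (k + 1)).le)) ?_ ?_ ?_ fun k => ?_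
  · have hββ : β ≤ βbar := by nlinarith [mul_le_gap hμ0 hμ1 hβ0 hβ, mul_pos hβ0 hμ0]
    exact (mul_nonneg (div_nonneg (by linarith) (by positivity)) (sq_nonneg _)).trans
      (norm_sq_le_lyapunov hμ0 hμ1 hβ0 hββ (by linarith [ht1 k])
        (by simpa [hxs] using hG (x k ω) xstar))
  · simp only [ht]; push_cast; ring
  · simpa only [ht] using (summable_one_div_weight hμ0 hr).mul_left (μ ^ 2 / (2 - 3 * μ))
  · exact hσ.mul_left Λ
  · have htt : Tendsto t atTop atTop := by
      rw [funext ht]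
      exact (tendsto_atTop_add_const_right _ _ tendsto_natCast_atTop_atTop).const_mul_atTop hμ0
    filter_upwards [htt.eventually_ge_atTop (2 + 12 / (2 - 3 * μ))] with k hk
    have h1 := integral_lyapunov_succ_le (ℙ := ℙ) (x := x k) (x' := x (k + 1)) (z := z k)
      (z' := z (k + 1)) (w := w k) (e := fun ω => Λ * Ebar (k + 1) ω) hμ0 hμ1 hβ0 hβ hk (hη k)
      hG hxs (hxz.mono fun ω h => (h k).1) (hxz.mono fun ω h => (h k).2)
      (hres k)
      (hgL k) (hgL (k + 1)) (hDL k) (hDL (k + 1)) (huL k) (huL (k + 1)) (hwL k)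
      ((hε (k + 1)).const_mul Λ)
    rw [integral_const_mul, show t k + μ = t (k + 1) by rw [ht, ht]; push_cast; ring] at h1
    have h2 := mul_le_mul_of_nonneg_left (hwφ k)
      (mul_nonneg (by positivity : 0 ≤ 3 * β / μ) (hτ0 k).le)
    refine h1.trans ((add_le_add_right h2 _).trans_eq ?_)
    ring
  · exact weighted_variance_step (hφ0 k) (hε0 (k + 1)) (hτ0 k) (hΓ (k + 1)) (hΘ (k + 1))
      (hφ k) (hκ k) (hΓΘ (k + 1))

end Stochastic

/-- Almost sure summability, `o(1/k²)` almost sure rates, and almost sure convergence of the iterates of VFOSA₊. -/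
theorem stmt_15 (p : ℕ) (hp : 1 ≤ p)
    (L ρ Lhat lam μ r β : ℝ)
    (hL : 0 < L) (hρ : 0 ≤ ρ) (hLρ : L * ρ < 1)
    (hLhat : L < Lhat) (hLhatρ : Lhat * ρ < 1)
    (hlam1 : 2 * ρ ≤ lam) (hlam2 : lam < 2 * (1 + Real.sqrt (1 - Lhat * ρ)) / Lhat)
    (hμ0 : 0 < μ) (hμ1 : μ < 2 / 3) (hr : r ≥ 2 + 1 / μ) (hβ0 : 0 < β)
    (F : EuclideanSpace ℝ (Fin p) → EuclideanSpace ℝ (Fin p))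
    (hF : ∀ a b, ⟪F a - F b, a - b⟫ ≥ (1 / L) * ‖F a - F b‖ ^ 2)
    (T : EuclideanSpace ℝ (Fin p) → Set (EuclideanSpace ℝ (Fin p)))
    (hT : ∀ a b u v, u ∈ T a → v ∈ T b → ⟪u - v, a - b⟫ ≥ -ρ * ‖u - v‖ ^ 2)
    (J : EuclideanSpace ℝ (Fin p) → EuclideanSpace ℝ (Fin p))
    (hJ : ∀ a, a - J a ∈ lam • T (J a))
    (G : EuclideanSpace ℝ (Fin p) → EuclideanSpace ℝ (Fin p))
    (hG : ∀ a, G a = (1 / lam) • (a - J (a - lam • F a)))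
    (xstar : EuclideanSpace ℝ (Fin p)) (hxstar : G xstar = 0)
    (βbar Λ : ℝ)
    (hβbar : βbar = (lam * (4 - Lhat * lam) - 4 * ρ) / (4 * (1 - ρ * Lhat)))
    (hΛ : Λ = (Lhat - L) / (L * Lhat))
    (hβub : β ≤ (2 - μ) * βbar / (2 + μ))
    {Ω : Type*} {m0 : MeasurableSpace Ω} (ℙ : Measure Ω) [IsProbabilityMeasure ℙ]
    (ℱ : Filtration ℕ m0)
    (x z y Gt Ft : ℕ → Ω → EuclideanSpace ℝ (Fin p))
    (hxmeas : ∀ k, StronglyMeasurable[ℱ k] (x k))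
    (hzmeas : ∀ k, StronglyMeasurable[ℱ k] (z k))
    (hFtmeas : ∀ k, StronglyMeasurable[ℱ (k + 1)] (Ft k))
    (x0 : EuclideanSpace ℝ (Fin p)) (hx0 : ∀ ω, x 0 ω = x0) (hz0 : ∀ ω, z 0 ω = x0)
    (hiter : ∀ᵐ ω ∂ℙ, ∀ k : ℕ,
      y k ω = (1 / (μ * ((k : ℝ) + r))) • ((μ * ((k : ℝ) + r) - 1) • x k ω + z k ω) ∧
      Gt k ω = (1 / lam) • (x k ω - J (x k ω - lam • Ft k ω)) ∧
      x (k + 1) ω = y k ω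
        - (2 * β * (μ * ((k : ℝ) + r) - 1) / (μ * ((k : ℝ) + r) - μ / 2)) • Gt k ω ∧
      z (k + 1) ω = z k ω + (μ / 2) • (x (k + 1) ω - y k ω))
    (Δ Ebar : ℕ → Ω → ℝ) (κ Θ σ' : ℕ → ℝ)
    (hΔmeas : ∀ k, StronglyMeasurable[ℱ (k + 1)] (Δ k))
    (hΔpos : ∀ k, ∀ᵐ ω ∂ℙ, 0 ≤ Δ k ω)
    (hEbarmeas : ∀ k, StronglyMeasurable[ℱ k] (Ebar k))
    (hEbarpos : ∀ k, ∀ᵐ ω ∂ℙ, 0 ≤ Ebar k ω)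
    (hEbar0 : ∀ ω, Ebar 0 ω = 0)
    (hκ : ∀ k, 0 < κ k ∧ κ k ≤ 1) (hΘ : ∀ k, 0 < Θ k) (hσ : ∀ k, 0 ≤ σ' k)
    (hVR1 : ∀ k, ℙ[(fun ω => ‖Ft k ω - F (x k ω)‖ ^ 2)|ℱ k] ≤ᵐ[ℙ] ℙ[Δ k|ℱ k])
    (hVR2 : ∀ k, ℙ[Δ k|ℱ k] ≤ᵐ[ℙ]
      fun ω => (1 - κ k) * (if k = 0 then 0 else Δ (k - 1) ω) + Θ k * Ebar k ω + σ' k ^ 2)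
    (hEbarle : ∀ k, ∀ᵐ ω ∂ℙ,
      Ebar k ω ≤ L * ⟪F (x k ω) - F (x (k - 1) ω), x k ω - x (k - 1) ω⟫)
    (hint1 : ∀ k, Integrable (fun ω => ‖G (x k ω)‖ ^ 2) ℙ)
    (hint2 : ∀ k, Integrable (fun ω => ‖Ft k ω - F (x k ω)‖ ^ 2) ℙ)
    (hint3 : ∀ k, Integrable (Δ k) ℙ)
    (hint4 : ∀ k, Integrable (Ebar k) ℙ)
    (hint5 : ∀ k, Integrable (fun ω => ‖z k ω - xstar‖ ^ 2) ℙ)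
    (Γ : ℕ → ℝ) (hΓ : ∀ k, 0 < Γ k)
    (hΓcond : ∀ k : ℕ, 1 ≤ k →
      κ k ≥ 1 - Γ (k - 1) * (μ * ((k : ℝ) + r - 2)) * (μ * ((k : ℝ) + r - 2) - 1)
          / (Γ k * (μ * ((k : ℝ) + r - 1)) * (μ * ((k : ℝ) + r - 1) - 1))
        + 5 * β / (μ * Γ k))
    (hΓΘ : ∀ k, Γ k * Θ k ≤ 2 * Λ)

    (hβstrict : β < (2 - μ) * βbar / (2 + μ))
    (hBsum : Summable (fun k : ℕ =>
      (μ * ((k : ℝ) + r - 1)) * (μ * ((k : ℝ) + r - 1) - 1) * σ' k ^ 2 / Θ k))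
    (Γlb Θlb : ℝ) (hΓlb : 0 < Γlb) (hΘlb : 0 < Θlb)
    (hΓge : ∀ k, Γlb ≤ Γ k) (hΘge : ∀ k, Θlb ≤ Θ k)
    (hΓΘ' : ∀ k, Γ k * Θ k ≤ Λ) :
    (∀ᵐ ω ∂ℙ,
      Summable (fun k : ℕ => ((k : ℝ) + 1) * ‖G (x k ω)‖ ^ 2)
      ∧ Summable (fun k : ℕ => ((k : ℝ) + 1) ^ 2 * ‖Ft k ω - F (x k ω)‖ ^ 2)
      ∧ Summable (fun k : ℕ => ((k : ℝ) + 1) * ‖x (k + 1) ω - x k ω‖ ^ 2)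
      ∧ Tendsto (fun k : ℕ => (k : ℝ) ^ 2 * ‖G (x k ω)‖ ^ 2) atTop (nhds 0)
      ∧ Tendsto (fun k : ℕ => (k : ℝ) ^ 2 * ‖x (k + 1) ω - x k ω‖ ^ 2) atTop (nhds 0))
    ∧ ∃ xbar : Ω → EuclideanSpace ℝ (Fin p), ∀ᵐ ω ∂ℙ,
        G (xbar ω) = 0
        ∧ Tendsto (fun k : ℕ => x k ω) atTop (nhds (xbar ω))
        ∧ Tendsto (fun k : ℕ => z k ω) atTop (nhds (xbar ω)) := by
  have hβ : β * (2 + μ) ≤ (2 - μ) * βbar := (le_div_iff₀ (by linarith)).1 hβub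
  have hβbar0 : 0 < βbar := by nlinarith
  have hlam0 : 0 < lam := by
    rcases (show 0 ≤ lam by linarith).eq_or_lt with h | h
    · have h1 : ρ = 0 := by linarith
      simp [← h, h1] at hβbar
      linarith
    · exact h
  have hΛ0 : 0 ≤ Λ := by
    rw [hΛ]; exact div_nonneg (by linarith) (mul_pos hL (hL.trans hLhat)).le
  have hres := residual_cocoercive hL hLhat hLhatρ hlam0 hF hT hJ hG hβbar hΛ
  have hGcoc : ∀ a b, βbar * ‖G a - G b‖ ^ 2 ≤ ⟪G a - G b, a - b⟫ := fun a b => by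
    have h1 : 0 ≤ ⟪F a - F b, a - b⟫ :=
      (mul_nonneg (one_div_pos.2 hL).le (sq_nonneg _)).trans (hF a b)
    linarith [hres a b, mul_nonneg hΛ0 (mul_nonneg hL.le h1)]
  have hFcont : Continuous F := continuous_of_cocoercive (one_div_pos.2 hL) hF
  have hGcont : Continuous G := continuous_of_cocoercive hβbar0 hGcoc
  have hJcont : Continuous J := (LipschitzWith.of_dist_le_mul (K := 1) fun a b => by
    rw [dist_eq_norm, dist_eq_norm, NNReal.coe_one, one_mul]
    exact resolvent_nonexpansive hlam0 hlam1 hT hJ a b).continuous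
  obtain ⟨t, ht⟩ : ∃ t : ℕ → ℝ, ∀ k : ℕ, t k = μ * ((k : ℝ) + r) := ⟨_, fun _ => rfl⟩
  obtain ⟨η, hη⟩ : ∃ η : ℕ → ℝ, ∀ k, η k = 2 * β * (t k - 1) / (t k - μ / 2) :=
    ⟨_, fun _ => rfl⟩
  have hμk : ∀ k : ℕ, 0 ≤ μ * (k : ℝ) := fun k => by positivity
  have ht1 : ∀ k, 1 + 2 * μ ≤ t k := fun k => by
    rw [ht]; linarith [one_add_le_weight hμ0 hr k, hμk k]
  obtain ⟨w, hw⟩ : ∃ w : ℕ → Ω → EuclideanSpace ℝ (Fin p), ∀ k ω,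
      w k ω = (1 / lam) • (x k ω - J (x k ω - lam • Ft k ω)) - G (x k ω) :=
    ⟨fun k ω => _, fun _ _ => rfl⟩
  have hwle : ∀ k ω, ‖w k ω‖ ≤ ‖Ft k ω - F (x k ω)‖ := fun k ω => by
    rw [hw, hG]; exact norm_residual_sub_le hlam0 hlam1 hT hJ _ _ _
  have hxz : ∀ᵐ ω ∂ℙ, ∀ k,
      x (k + 1) ω = x k ω - (1 / t k) • (x k ω - z k ω) - η k • (G (x k ω) + w k ω)
      ∧ z (k + 1) ω = z k ω - (μ / 2 * η k) • (G (x k ω) + w k ω) := by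
    filter_upwards [hiter] with ω hω k
    obtain ⟨h1, h2, h3, h4⟩ := hω k
    have ht0 : t k ≠ 0 := by linarith [ht1 k]
    rw [← ht] at h1 h3
    rw [← hη, h2] at h3
    rw [h3, sub_sub_cancel_left] at h4
    rw [hw, add_sub_cancel, h3, h4, h1]
    refine ⟨?_, by module⟩
    rw [smul_add, smul_smul, mul_sub, one_div_mul_cancel ht0]
    module
  have hxm : ∀ k, AEStronglyMeasurable (x k) ℙ := fun k =>
    ((hxmeas k).mono (ℱ.le k)).aestronglyMeasurable
  have hzm : ∀ k, AEStronglyMeasurable (z k) ℙ := fun k =>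
    ((hzmeas k).mono (ℱ.le k)).aestronglyMeasurable
  have hFtm : ∀ k, AEStronglyMeasurable (Ft k) ℙ := fun k =>
    ((hFtmeas k).mono (ℱ.le (k + 1))).aestronglyMeasurable
  have hgL : ∀ k, MemLp (fun ω => G (x k ω)) 2 ℙ := fun k =>
    (memLp_two_iff_integrable_sq_norm (hGcont.comp_aestronglyMeasurable (hxm k))).2 (hint1 k)
  have heL : ∀ k, MemLp (fun ω => Ft k ω - F (x k ω)) 2 ℙ := fun k =>
    (memLp_two_iff_integrable_sq_norm
      ((hFtm k).sub (hFcont.comp_aestronglyMeasurable (hxm k)))).2 (hint2 k)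
  have hwL : ∀ k, MemLp (w k) 2 ℙ := fun k => by
    refine (heL k).of_le ?_ (ae_of_all _ (hwle k))
    rw [funext (hw k)]
    exact (((hxm k).sub (hJcont.comp_aestronglyMeasurable
      ((hxm k).sub ((hFtm k).const_smul lam)))).const_smul (1 / lam)).sub (hgL k).1
  have huL : ∀ k, MemLp (fun ω => z k ω - xstar) 2 ℙ := fun k =>
    (memLp_two_iff_integrable_sq_norm ((hzm k).sub aestronglyMeasurable_const)).2 (hint5 k)
  have hDL : ∀ k, MemLp (fun ω => x k ω - z k ω) 2 ℙ :=
    memLp_gap (t := t) (c := fun k => (1 - μ / 2) * η k) (fun ω => by rw [hx0, hz0]) hgL hwL (by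
      filter_upwards [hxz] with ω hω k
      rw [(hω k).1, (hω k).2]
      module)
  have hφ0 : ∀ k, 0 ≤ ∫ ω, Δ k ω ∂ℙ := fun k => integral_nonneg_of_ae (hΔpos k)
  have hε0 : ∀ k, 0 ≤ ∫ ω, Ebar k ω ∂ℙ := fun k => integral_nonneg_of_ae (hEbarpos k)
  have heφ : ∀ k, ∫ ω, ‖Ft k ω - F (x k ω)‖ ^ 2 ∂ℙ ≤ ∫ ω, Δ k ω ∂ℙ := fun k =>
    integral_le_of_condExp_le_condExp (ℱ.le k) (hVR1 k)
  have hwφ : ∀ k, ∫ ω, ‖w k ω‖ ^ 2 ∂ℙ ≤ ∫ ω, Δ k ω ∂ℙ := fun k =>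
    (integral_mono ((memLp_two_iff_integrable_sq_norm (hwL k).1).1 (hwL k)) (hint2 k) fun ω =>
      pow_le_pow_left₀ (norm_nonneg _) (hwle k ω) 2).trans (heφ k)
  have hφrec : ∀ k, ∫ ω, Δ (k + 1) ω ∂ℙ ≤ (1 - κ (k + 1)) * ∫ ω, Δ k ω ∂ℙ
      + Θ (k + 1) * ∫ ω, Ebar (k + 1) ω ∂ℙ + σ' (k + 1) ^ 2 := fun k =>
    integral_le_of_condExp_le_affine (ℱ.le (k + 1)) (hint3 k) (hint4 (k + 1))
      (by simpa using hVR2 (k + 1))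
  have hτ0 : ∀ k, 0 < t k * (t k - 1) := fun k =>
    mul_pos (by linarith [ht1 k]) (by linarith [ht1 k])
  have hsumφ : Summable fun k => t k * (t k - 1) * ∫ ω, Δ k ω ∂ℙ := by
    refine summable_weighted_variance (Γ := Γ) hμ0 hμ1 hβ0 hβ hr hΛ0 ht hη hGcoc hxstar hxz
      (fun k => ?_) hgL hDL huL hwL hint4 hε0 hφ0 hwφ hφrec hΓ hΘ (fun k => ?_) hΓΘ' ?_
    · filter_upwards [hEbarle (k + 1)] with ω hω
      rw [Nat.add_sub_cancel] at hω
      linarith [hres (x (k + 1) ω) (x k ω), mul_le_mul_of_nonneg_left hω hΛ0]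
    · refine Eq.trans_le ?_ (hΓcond (k + 1) (by lia))
      have := hΓ (k + 1)
      rw [Nat.add_sub_cancel, ht]
      push_cast
      congr 1
      · congr 2 <;> ring
      · field_simp
    · refine ((summable_nat_add_iff 1).2 hBsum).congr fun k => ?_
      simp only [ht]; push_cast; ring
  have hsumerr : ∀ᵐ ω ∂ℙ, Summable fun k => t k ^ 2 * ‖Ft k ω - F (x k ω)‖ ^ 2 := by
    refine ae_summable_of_summable_integral (fun k => ae_of_all _ fun ω => by positivity)
      (fun k => (hint2 k).const_mul _) ?_
    refine (hsumφ.mul_left ((1 + 2 * μ) / (2 * μ))).of_nonneg_of_le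
      (fun k => integral_nonneg fun ω => by positivity) fun k => ?_
    rw [integral_const_mul, ← mul_assoc]
    refine mul_le_mul ?_ (heφ k) (integral_nonneg fun ω => sq_nonneg _)
      (mul_nonneg (by positivity) (hτ0 k).le)
    rw [div_mul_eq_mul_div, le_div_iff₀ (by positivity)]
    nlinarith [ht1 k]
  have htraj : ∀ᵐ ω ∂ℙ, IsTrajectory μ β βbar r G t η (fun k => x k ω) (fun k => z k ω)
      (fun k => w k ω) := by
    filter_upwards [hxz, hsumerr] with ω h1 h2
    exact
      { mu_pos := hμ0
        mu_lt := hμ1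
        beta_pos := hβ0
        beta_le := hβ
        r_ge := hr
        t_eq := ht
        eta_eq := hη
        coercive := hGcoc
        x_succ := fun k => (h1 k).1
        z_succ := fun k => (h1 k).2
        summable_error := h2.of_nonneg_of_le (fun k => by positivity) fun k =>
          mul_le_mul_of_nonneg_left (pow_le_pow_left₀ (norm_nonneg _) (hwle k ω) 2)
            (sq_nonneg _) }
  refine ⟨?_, ?_⟩
  · filter_upwards [htraj, hsumerr] with ω h herr
    have hs1 := h.summable_natCast_mul 1 (fun k => sq_nonneg ‖G (x k ω)‖)
      (by simpa only [pow_one] using (h.lyapunov_tendsto hxstar).2)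
    have hs2 := h.summable_natCast_mul 1 (fun k => sq_nonneg ‖x (k + 1) ω - x k ω‖)
      (by simpa only [pow_one] using h.summable_step hxstar)
    simp only [pow_one] at hs1 hs2
    exact ⟨hs1, h.summable_natCast_mul 2 (fun k => sq_nonneg _) herr, hs2,
      h.tendsto_natCast_sq_mul (fun k => sq_nonneg _) (h.sq_mul_residual_tendsto hxstar),
      h.tendsto_natCast_sq_mul (fun k => sq_nonneg _) (h.sq_mul_step_tendsto hxstar)⟩
  · have hlim : ∀ᵐ ω ∂ℙ, ∃ xbar, G xbar = 0 ∧ Tendsto (fun k => x k ω) atTop (nhds xbar)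
        ∧ Tendsto (fun k => z k ω) atTop (nhds xbar) :=
      htraj.mono fun ω h => h.exists_limit hGcont hxstar
    exact ⟨fun ω => Classical.epsilon fun xbar => G xbar = 0
        ∧ Tendsto (fun k => x k ω) atTop (nhds xbar) ∧ Tendsto (fun k => z k ω) atTop (nhds xbar),
      hlim.mono fun ω h => Classical.epsilon_spec h⟩
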